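/- arXiv:1407.7923 — 2 statements merged into one kernel-verified Lean document; each statement's English description precedes it below -/
import Mathlib

section
/- Let F be a finite field of characteristic p and order q = p^n, and suppose W_{F,d} takes exactly three values 0, a, b on F* with a, b nonzero integers. Then either v_p(a) > n/2 and v_p(b) > n/2, or v_p(a) = v_p(b) = n/2 and |a−b| is a power of p exceeding √q; moreover the second case is impossible when p = 2 or p = 3. -/
open Complex

/-- The canonical additive character of a finite field `F` of characteristic `p`:
`ψ(x) = exp(2πi · Tr_{F/F_p}(x) / p)`. -/
noncomputable def psi (p : ℕ) [Fact p.Prime] (F : Type*) [Field F] [Fintype F]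
    [Algebra (ZMod p) F] (x : F) : ℂ :=
  Complex.exp (2 * Real.pi * Complex.I * ((Algebra.trace (ZMod p) F x).val : ℂ) / (p : ℂ))

/-- The Weil sum `W_{F,d}(u) = Σ_{x ∈ F} ψ(x^d + u x)`. -/
noncomputable def weilSum (p : ℕ) [Fact p.Prime] (F : Type*) [Field F] [Fintype F]
    [Algebra (ZMod p) F] (d : ℕ) (u : F) : ℂ :=
  ∑ x : F, psi p F (x ^ d + u * x)


theorem pow_bij {F : Type*} [Field F] [Fintype F] (d : ℕ) (hd : 0 < d)
    (hcop : Nat.Coprime d (Fintype.card F - 1)) : Function.Bijective (fun x : F => x ^ d) := by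
  classical
  rw [← Finite.injective_iff_bijective]
  intro x y h
  simp only at h
  by_cases hx : x = 0
  · subst hx
    rw [zero_pow hd.ne'] at h
    exact (pow_eq_zero_iff hd.ne' |>.mp h.symm).symm
  by_cases hy : y = 0
  · subst hy
    rw [zero_pow hd.ne'] at h
    exact (pow_eq_zero_iff hd.ne' |>.mp h)
  have hc : (Nat.card Fˣ).Coprime d := by
    rw [Nat.card_eq_fintype_card, Fintype.card_units]; exact hcop.symm
  have : Units.mk0 x hx = Units.mk0 y hy := by
    apply (powCoprime hc).injective
    ext
    simpa [powCoprime] using h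
  simpa using congrArg Units.val this

theorem neg_pow_cop {F : Type*} [Field F] [Fintype F] (d : ℕ)
    (hcop : Nat.Coprime d (Fintype.card F - 1)) (x : F) : (-x) ^ d = - x ^ d := by
  rcases Nat.even_or_odd d with h | h
  · have ho : Odd (Fintype.card F - 1) := by
      rw [← Nat.not_even_iff_odd]
      intro he
      have := Nat.dvd_gcd h.two_dvd he.two_dvd
      rw [hcop] at this; omega
    have h1 : (-1 : F) ^ (Fintype.card F - 1) = 1 :=
      FiniteField.pow_card_sub_one_eq_one _ (by simp)
    rw [ho.neg_one_pow] at h1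
    rw [h.neg_pow]
    calc x ^ d = 1 * x ^ d := by ring
      _ = (-1) * x ^ d := by rw [h1]
      _ = _ := by ring
  · exact h.neg_pow x

section
variable {F : Type*} [Field F] [Fintype F] [DecidableEq F]

def cnt (F : Type*) [Field F] [Fintype F] [DecidableEq F] (d : ℕ) (v : F) : ℕ :=
  (Finset.univ.filter fun s : F => s ^ d + (-s - v) ^ d + 1 = 0).card

noncomputable def WW (e : AddChar F ℂ) (d : ℕ) (u : F) : ℂ := ∑ x : F, e (x ^ d + u * x)

theorem WW_zero (e : AddChar F ℂ) (he : e.IsPrimitive) (d : ℕ) (hd : 0 < d)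
    (hcop : Nat.Coprime d (Fintype.card F - 1)) : WW e d 0 = 0 := by
  have := AddChar.sum_mulShift (1 : F) he
  simp only [mul_one, one_ne_zero, if_false, Nat.cast_zero] at this
  rw [WW, ← this]
  exact Fintype.sum_bijective _ (pow_bij d hd hcop) _ _ fun x => by simp

theorem WW_pow_sum (e : AddChar F ℂ) (he : e.IsPrimitive) (d : ℕ) (hd : 0 < d)
    (hcop : Nat.Coprime d (Fintype.card F - 1)) (c : F) :
    ∑ z : F, e (z ^ d * c) = if c = 0 then (Fintype.card F : ℂ) else 0 := by
  have := AddChar.sum_mulShift c he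
  rw [Fintype.sum_bijective _ (pow_bij d hd hcop) _ (fun z => e (z * c)) fun x => rfl, this]
  split_ifs <;> simp

theorem WW_sum1 (e : AddChar F ℂ) (he : e.IsPrimitive) (d : ℕ) (hd : 0 < d) :
    ∑ u, WW e d u = (Fintype.card F : ℂ) := by
  unfold WW
  rw [Finset.sum_comm]
  simp_rw [AddChar.map_add_eq_mul, ← Finset.mul_sum, AddChar.sum_mulShift _ he]
  simp [hd.ne']

theorem WW_sum2 (e : AddChar F ℂ) (he : e.IsPrimitive) (d : ℕ) (hd : 0 < d)
    (hcop : Nat.Coprime d (Fintype.card F - 1)) (v : F) :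
    ∑ u, WW e d u * WW e d (v * u) = if v = 1 then (Fintype.card F : ℂ) ^ 2 else 0 := by
  have e1 : ∀ u, WW e d u * WW e d (v * u)
      = ∑ y : F, ∑ x : F, e (x ^ d + y ^ d) * e (u * (x + v * y)) := by
    intro u
    unfold WW
    rw [Finset.sum_mul_sum, Finset.sum_comm]
    refine Finset.sum_congr rfl fun y _ => Finset.sum_congr rfl fun x _ => ?_
    rw [← AddChar.map_add_eq_mul, ← AddChar.map_add_eq_mul]
    congr 1; ring
  simp_rw [e1]
  rw [Finset.sum_comm]
  have e2 : ∀ y : F, ∑ u : F, ∑ x : F, e (x ^ d + y ^ d) * e (u * (x + v * y))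
      = (Fintype.card F : ℂ) * e (y ^ d * (1 - v ^ d)) := by
    intro y
    rw [Finset.sum_comm]
    simp_rw [← Finset.mul_sum, AddChar.sum_mulShift _ he]
    rw [Finset.sum_eq_single (-(v * y))]
    · simp only [neg_add_cancel, if_true]
      rw [mul_comm, neg_pow_cop d hcop]
      congr 2; ring
    · intro x _ hx
      rw [if_neg]
      · simp
      · intro h; exact hx (eq_neg_of_add_eq_zero_left h)
    · simp
  rw [Finset.sum_congr rfl fun y _ => e2 y, ← Finset.mul_sum, WW_pow_sum e he d hd hcop]
  have : (1 - v ^ d = 0) ↔ v = 1 := by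
    rw [sub_eq_zero, eq_comm]
    constructor
    · intro h
      apply (pow_bij d hd hcop).injective
      simpa using h
    · rintro rfl; simp
  simp only [this]
  split_ifs <;> ring

theorem WW_sum3 (e : AddChar F ℂ) (he : e.IsPrimitive) (d : ℕ) (hd : 0 < d)
    (hcop : Nat.Coprime d (Fintype.card F - 1)) (v : F) :
    ∑ u, WW e d u ^ 2 * WW e d (v * u) = (Fintype.card F : ℂ) ^ 2 * cnt F d v := by
  have e1 : ∀ u, WW e d u ^ 2 * WW e d (v * u)
      = ∑ z : F, ∑ x : F, ∑ y : F, e (x ^ d + y ^ d + z ^ d) * e (u * (x + y + v * z)) := by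
    intro u
    unfold WW
    rw [pow_two, Finset.sum_mul_sum, mul_comm, Finset.sum_mul]
    refine Finset.sum_congr rfl fun z _ => ?_
    rw [Finset.mul_sum]
    refine Finset.sum_congr rfl fun x _ => ?_
    rw [Finset.mul_sum]
    refine Finset.sum_congr rfl fun y _ => ?_
    simp_rw [← AddChar.map_add_eq_mul]
    congr 1; ring
  simp_rw [e1]
  rw [Finset.sum_comm]
  have e2 : ∀ z : F, ∑ u : F, ∑ x : F, ∑ y : F, e (x ^ d + y ^ d + z ^ d) * e (u * (x + y + v * z))
      = (Fintype.card F : ℂ) * ∑ x : F, e (x ^ d + (-x - v * z) ^ d + z ^ d) := by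
    intro z
    rw [Finset.sum_comm, Finset.mul_sum]
    refine Finset.sum_congr rfl fun x _ => ?_
    rw [Finset.sum_comm]
    simp_rw [← Finset.mul_sum, AddChar.sum_mulShift _ he]
    rw [Finset.sum_eq_single (-x - v * z)]
    · rw [if_pos (by ring), mul_comm]
    · intro y _ hy
      rw [if_neg]
      · simp
      · intro h; apply hy; linear_combination h
    · simp
  rw [Finset.sum_congr rfl fun y _ => e2 y, ← Finset.mul_sum, pow_two, mul_assoc]
  congr 1
  rw [← Finset.add_sum_erase _ _ (Finset.mem_univ (0 : F))]
  have e3 : ∑ x : F, e (x ^ d + (-x - v * 0) ^ d + 0 ^ d) = Fintype.card F := by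
    have : ∀ x : F, x ^ d + (-x - v * 0) ^ d + 0 ^ d = 0 := by
      intro x; rw [mul_zero, sub_zero, neg_pow_cop d hcop, zero_pow hd.ne']; ring
    rw [Finset.sum_congr rfl fun x _ => by rw [this x]]
    simp
  have e4 : ∀ z ∈ Finset.univ.erase (0 : F), ∑ x : F, e (x ^ d + (-x - v * z) ^ d + z ^ d)
      = ∑ s : F, e (z ^ d * (s ^ d + (-s - v) ^ d + 1)) := by
    intro z hz
    have hz0 := Finset.ne_of_mem_erase hz
    symm
    refine Fintype.sum_equiv (Equiv.mulLeft₀ z hz0) _ _ fun s => ?_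
    congr 1
    change z ^ d * (s ^ d + (-s - v) ^ d + 1) = (z * s) ^ d + (-(z * s) - v * z) ^ d + z ^ d
    rw [show -(z * s) - v * z = z * (-s - v) by ring, mul_pow, mul_pow]; ring
  rw [e3, Finset.sum_congr rfl e4, Finset.sum_comm]
  have e5 : ∀ s : F, ∑ z ∈ Finset.univ.erase (0 : F), e (z ^ d * (s ^ d + (-s - v) ^ d + 1))
      = (if s ^ d + (-s - v) ^ d + 1 = 0 then (Fintype.card F : ℂ) else 0) - 1 := by
    intro s
    rw [← WW_pow_sum e he d hd hcop, ← Finset.add_sum_erase _ _ (Finset.mem_univ (0 : F))]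
    simp [hd.ne']
  rw [Finset.sum_congr rfl fun s _ => e5 s, Finset.sum_sub_distrib, ← Finset.sum_filter]
  simp [cnt]
  ring

theorem sum_units_of_zero (f : F → ℂ) (h0 : f 0 = 0) : ∑ u : Fˣ, f u = ∑ u : F, f u := by
  rw [← Finset.add_sum_erase _ _ (Finset.mem_univ (0 : F)), h0, zero_add]
  refine Finset.sum_bij (fun u _ => (u : F)) ?_ ?_ ?_ ?_
  · intro u _; simp
  · intro u _ v _ h; exact Units.ext h
  · intro x hx
    exact ⟨Units.mk0 x (Finset.ne_of_mem_erase hx), by simp, rfl⟩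
  · intros; rfl

theorem cnt_two (h2 : (2 : F) = 0) (d : ℕ) : 2 ∣ cnt F d 1 := by
  have : Fact (Nat.Prime 2) := ⟨Nat.prime_two⟩
  have hcn : cnt F d 1 = Fintype.card {s : F // s ^ d + (-s - 1) ^ d + 1 = 0} := by
    rw [cnt, Fintype.card_subtype]
  let f : Function.End {s : F // s ^ d + (-s - 1) ^ d + 1 = 0} := fun s => ⟨-s.1 - 1, by
    have := s.2
    rw [show -(-s.1 - 1) - 1 = s.1 by ring, add_comm ((-s.1 - 1) ^ d)]; exact this⟩
  have hf : f ^ 2 ^ 1 = 1 := by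
    funext s
    rw [pow_one, pow_two]
    apply Subtype.ext
    change -(-s.1 - 1) - 1 = s.1
    ring
  have := Equiv.Perm.card_fixedPoints_modEq hf
  have h0 : Fintype.card f.fixedPoints = 0 := by
    rw [Fintype.card_eq_zero_iff]
    constructor
    rintro ⟨s, hs⟩
    have : -s.1 - 1 = s.1 := congrArg Subtype.val hs
    have h1 : (1 : F) = 0 := by linear_combination -this - s.1 * h2
    exact one_ne_zero h1
  rw [h0] at this
  rw [hcn]
  exact (Nat.modEq_zero_iff_dvd).mp this

theorem cnt_three (h3 : (3 : F) = 0) (hq3 : 3 ∣ Fintype.card F) (d : ℕ) (hd : 0 < d)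
    (hcop : Nat.Coprime d (Fintype.card F - 1)) : 3 ∣ cnt F d 1 := by
  have : Fact (Nat.Prime 3) := ⟨Nat.prime_three⟩
  let T := {s : F × F // s.2 ^ d + (-s.2 - s.1) ^ d + s.1 ^ d = 0}
  let f : Function.End T := fun s => ⟨(s.1.2, -s.1.2 - s.1.1), by
    have := s.2
    simp only
    rw [show -(-s.1.2 - s.1.1) - s.1.2 = s.1.1 by ring]
    linear_combination this⟩
  have hf : f ^ 3 ^ 1 = 1 := by
    funext s
    rw [pow_one, pow_succ, pow_two]
    apply Subtype.ext
    change (-(-s.1.2 - s.1.1) - s.1.2, -(-(-s.1.2 - s.1.1) - s.1.2) - (-s.1.2 - s.1.1)) = s.1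
    ext
    · simp
    · simp only; ring
  have key := Equiv.Perm.card_fixedPoints_modEq hf
  have hfix : Fintype.card f.fixedPoints = Fintype.card F := by
    symm
    refine Fintype.card_congr (Equiv.ofBijective (fun x : F => (⟨⟨(x, x), ?_⟩, ?_⟩ : f.fixedPoints)) ⟨?_, ?_⟩)
    · simp only
      rw [show -x - x = x by linear_combination (-x) * h3]
      linear_combination x ^ d * h3
    · apply Subtype.ext
      change (x, -x - x) = (x, x)
      rw [show -x - x = x by linear_combination (-x) * h3]
    · intro x y h
      exact congrArg (fun z : f.fixedPoints => z.1.1.1) h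
    · rintro ⟨⟨⟨x, y⟩, h⟩, hs⟩
      have : (y, -y - x) = (x, y) := congrArg Subtype.val hs
      have hxy : y = x := congrArg Prod.fst this
      subst hxy
      exact ⟨y, rfl⟩
  have hT : Fintype.card T = Fintype.card F + (Fintype.card F - 1) * cnt F d 1 := by
    have a1 : Fintype.card T = ∑ z : F, (Finset.univ.filter fun x : F => x ^ d + (-x - z) ^ d + z ^ d = 0).card := by
      rw [Fintype.card_subtype, Finset.card_filter, Fintype.sum_prod_type]
      simp_rw [Finset.card_filter]
    rw [a1, ← Finset.add_sum_erase _ _ (Finset.mem_univ (0 : F))]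
    congr 1
    · rw [Finset.filter_true_of_mem, Finset.card_univ]
      intro x _
      rw [sub_zero, neg_pow_cop d hcop, zero_pow hd.ne']; ring
    · rw [Finset.sum_const_nat (m := cnt F d 1)]
      · rw [Finset.card_erase_of_mem (Finset.mem_univ _), Finset.card_univ]
      · intro z hz
        have hz0 := Finset.ne_of_mem_erase hz
        rw [cnt]
        symm
        refine Finset.card_bij (fun s _ => z * s) ?_ ?_ ?_
        · intro s hs
          simp only [Finset.mem_filter, Finset.mem_univ, true_and] at hs ⊢
          rw [show -(z * s) - z = z * (-s - 1) by ring, mul_pow, mul_pow]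
          linear_combination z ^ d * hs
        · intro s _ t _ h; exact mul_left_cancel₀ hz0 h
        · intro x hx
          simp only [Finset.mem_filter, Finset.mem_univ, true_and] at hx
          refine ⟨z⁻¹ * x, ?_, by field_simp⟩
          simp only [Finset.mem_filter, Finset.mem_univ, true_and]
          have hzd : z ^ d ≠ 0 := pow_ne_zero _ hz0
          apply mul_left_cancel₀ hzd
          have e1 : z ^ d * (z⁻¹ * x) ^ d = x ^ d := by rw [← mul_pow]; congr 1; field_simp
          have e2 : z ^ d * (-(z⁻¹ * x) - 1) ^ d = (-x - z) ^ d := by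
            rw [← mul_pow]; congr 1; field_simp
          linear_combination e1 + e2 + hx
  rw [hfix, hT] at key
  have k0 : (Fintype.card F - 1) * cnt F d 1 ≡ 0 [MOD 3] := by
    have : Fintype.card F + (Fintype.card F - 1) * cnt F d 1 ≡ Fintype.card F + 0 [MOD 3] := key
    exact Nat.ModEq.add_left_cancel' _ this
  have k1 := (Nat.modEq_zero_iff_dvd).mp k0
  rcases (Nat.prime_three.dvd_mul).mp k1 with h | h
  · have := Fintype.card_pos (α := F)
    omega
  · exact h
end

set_option maxHeartbeats 1000000 in
theorem core_w {G : Type*} [CommGroup G] [Fintype G] [DecidableEq G] (p n : ℕ) (hp : p.Prime)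
    (a b : ℤ) (ha : a ≠ 0) (hb : b ≠ 0) (hab : a ≠ b) (w : G → ℤ) (M : G → ℕ)
    (hw : ∀ u, w u = 0 ∨ w u = a ∨ w u = b) (hwa : ∃ u, w u = a) (hwb : ∃ u, w u = b)
    (h1 : ∑ u, w u = (p : ℤ) ^ n)
    (h2 : ∀ v, ∑ u, w u * w (v * u) = if v = 1 then ((p : ℤ) ^ n) ^ 2 else 0)
    (h3 : ∀ v, ∑ u, w u ^ 2 * w (v * u) = ((p : ℤ) ^ n) ^ 2 * M v) :
    a * b < 0 ∧ ((p : ℤ) ^ n) * M 1 = (p : ℤ) ^ n * (a + b) - a * b ∧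
    (∀ a' b' L : ℤ, ∀ α β γ : ℕ, a = p ^ α * a' → b = p ^ β * b' → a - b = p ^ γ * L →
      IsCoprime (p : ℤ) a' → IsCoprime (p : ℤ) b' → IsCoprime (p : ℤ) L →
      |L| * (p : ℤ) ^ n ≤ p ^ (α + β)) := by
  set q : ℤ := (p : ℤ) ^ n with hq
  have hp0 : (0 : ℤ) < p := by exact_mod_cast hp.pos
  have hq0 : 0 < q := by positivity
  -- pointwise relation
  have hrel : ∀ u, w u ^ 3 = (a + b) * w u ^ 2 - a * b * w u := by
    intro u; rcases hw u with h | h | h <;> rw [h] <;> ring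
  have hS2 : ∑ u, w u ^ 2 = q ^ 2 := by
    have := h2 1
    simp only [one_mul, if_true] at this
    rw [← this]; exact Finset.sum_congr rfl fun u _ => by ring
  have hS3 : ∑ u, w u ^ 3 = q ^ 2 * M 1 := by
    rw [← h3 1]; exact Finset.sum_congr rfl fun u _ => by rw [one_mul]; ring
  have hS3' : ∑ u, w u ^ 3 = (a + b) * q ^ 2 - a * b * q := by
    rw [Finset.sum_congr rfl fun u _ => hrel u, Finset.sum_sub_distrib, ← Finset.mul_sum,
      ← Finset.mul_sum, hS2, h1]
  have hM1 : q * M 1 = q * (a + b) - a * b := by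
    apply mul_left_cancel₀ hq0.ne'
    linear_combination hS3' - hS3
  have hS4 : ∑ u, w u ^ 4 = q ^ 2 * ((a + b) * M 1 - a * b) := by
    have : ∀ u, w u ^ 4 = (a + b) * w u ^ 3 - a * b * w u ^ 2 := by
      intro u; linear_combination w u * hrel u
    rw [Finset.sum_congr rfl fun u _ => this u, Finset.sum_sub_distrib, ← Finset.mul_sum,
      ← Finset.mul_sum, hS2, hS3]; ring
  have hsumM : ∑ v, (M v : ℤ) = q := by
    have hq2 : q ^ 2 ≠ 0 := by positivity
    apply mul_left_cancel₀ hq2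
    rw [Finset.mul_sum, Finset.sum_congr rfl fun v _ => (h3 v).symm, Finset.sum_comm]
    have : ∀ u, ∑ v, w u ^ 2 * w (v * u) = w u ^ 2 * q := by
      intro u
      rw [← Finset.mul_sum, ← h1]
      congr 1
      exact Fintype.sum_equiv (Equiv.mulRight u) _ _ fun v => rfl
    rw [Finset.sum_congr rfl fun u _ => this u, ← Finset.sum_mul, hS2]
  have hcor : ∀ u u', ∑ v, w (v * u) * w (v * u') = if u = u' then q ^ 2 else 0 := by
    intro u u'
    have := h2 (u' * u⁻¹)
    have h' : (u' * u⁻¹ = 1) ↔ (u = u') := by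
      rw [mul_inv_eq_one]; exact eq_comm
    simp only [h'] at this
    rw [← this]
    refine Fintype.sum_equiv (Equiv.mulRight u) _ _ fun v => ?_
    simp only [Equiv.coe_mulRight]
    congr 2
    rw [mul_comm v u, ← mul_assoc, inv_mul_cancel_right, mul_comm]
  have hsumM2 : ∑ v, (M v : ℤ) ^ 2 = (a + b) * M 1 - a * b := by
    have hq4 : q ^ 4 ≠ 0 := by positivity
    apply mul_left_cancel₀ hq4
    have e1 : q ^ 4 * ∑ v, (M v : ℤ) ^ 2
        = ∑ v, ∑ u, ∑ u', w u ^ 2 * w u' ^ 2 * (w (v * u) * w (v * u')) := by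
      rw [Finset.mul_sum]
      refine Finset.sum_congr rfl fun v _ => ?_
      have : q ^ 4 * (M v : ℤ) ^ 2 = (q ^ 2 * M v) * (q ^ 2 * M v) := by ring
      rw [this, ← h3 v, Finset.sum_mul_sum]
      refine Finset.sum_congr rfl fun u _ => Finset.sum_congr rfl fun u' _ => by ring
    rw [e1, Finset.sum_comm]
    have e2 : ∀ u, ∑ v, ∑ u', w u ^ 2 * w u' ^ 2 * (w (v * u) * w (v * u')) = q ^ 2 * w u ^ 4 := by
      intro u
      rw [Finset.sum_comm]
      simp_rw [← Finset.mul_sum, hcor u]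
      simp
      ring
    rw [Finset.sum_congr rfl fun u _ => e2 u, ← Finset.mul_sum, hS4]; ring
  -- split off 1
  have s1 : (M 1 : ℤ) + ∑ v ∈ Finset.univ.erase 1, (M v : ℤ) = q := by
    rw [← hsumM, Finset.add_sum_erase _ (fun v => (M v : ℤ)) (Finset.mem_univ _)]
  have s2 : (M 1 : ℤ) ^ 2 + ∑ v ∈ Finset.univ.erase 1, (M v : ℤ) ^ 2 = (a + b) * M 1 - a * b := by
    rw [← hsumM2, Finset.add_sum_erase _ (fun v => (M v : ℤ) ^ 2) (Finset.mem_univ _)]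
  set X := ∑ v ∈ Finset.univ.erase 1, (M v : ℤ) with hX
  set Y := ∑ v ∈ Finset.univ.erase 1, (M v : ℤ) ^ 2 with hY
  have hXY : q * Y = -(a * b) * X := by
    linear_combination q * s2 + a * b * s1 - M 1 * hM1
  have hY0 : 0 ≤ Y := Finset.sum_nonneg fun _ _ => by positivity
  obtain ⟨ua, hua⟩ := hwa
  obtain ⟨ub, hub⟩ := hwb
  have hne : ua ≠ ub := by rintro rfl; exact hab (hua.symm.trans hub)
  have hsq : a ^ 2 + b ^ 2 ≤ q ^ 2 := by
    rw [← hS2, ← hua, ← hub, ← Finset.sum_pair (f := fun u => w u ^ 2) hne]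
    exact Finset.sum_le_sum_of_subset_of_nonneg (Finset.subset_univ _) fun _ _ _ => by positivity
  have ha2 : 0 < a ^ 2 := by positivity
  have hb2 : 0 < b ^ 2 := by positivity
  have haq : a < q := by nlinarith
  have hbq : b < q := by nlinarith
  have hXpos : 0 < X := by
    have : q * X = (q - a) * (q - b) := by linear_combination q * s1 - hM1
    have h' : 0 < q * X := by rw [this]; exact mul_pos (by linarith) (by linarith)
    exact pos_of_mul_pos_right h' hq0.le
  have habne : a * b ≠ 0 := mul_ne_zero ha hb
  have habneg : a * b < 0 := by
    rcases lt_or_gt_of_ne habne with h | h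
    · exact h
    · nlinarith [mul_nonneg hq0.le hY0, mul_pos h hXpos]
  refine ⟨habneg, hM1, ?_⟩
  intro a' b' L α β γ ea eb eL ca cb cL
  -- divisibility
  have hdiv : ∀ x y : ℤ, (∀ u, w u = 0 ∨ w u = x ∨ w u = y) → ∀ v, v ≠ 1 →
      x * (x - y) ∣ q ^ 2 * M v := by
    intro x y hxy v hv
    have e : q ^ 2 * M v = ∑ u, (w u ^ 2 - y * w u) * w (v * u) := by
      have h2v := h2 v
      rw [if_neg hv] at h2v
      simp_rw [sub_mul, Finset.sum_sub_distrib, mul_assoc, ← Finset.mul_sum, h2v, h3 v]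
      ring
    rw [e]
    refine Finset.dvd_sum fun u _ => Dvd.dvd.mul_right ?_ _
    rcases hxy u with h | h | h <;> rw [h]
    · simp
    · exact ⟨1, by ring⟩
    · exact ⟨0, by ring⟩
  have hcop_ab : IsCoprime a' b' := by
    rw [Int.isCoprime_iff_gcd_eq_one]
    by_contra hg
    obtain ⟨l, hl, hlg⟩ := Nat.exists_prime_and_dvd hg
    have hla' : (l : ℤ) ∣ a' := (Int.natCast_dvd_natCast.mpr hlg).trans (Int.gcd_dvd_left ..)
    have hlb' : (l : ℤ) ∣ b' := (Int.natCast_dvd_natCast.mpr hlg).trans (Int.gcd_dvd_right ..)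
    have hla : (l : ℤ) ∣ a := ea ▸ hla'.mul_left _
    have hlb : (l : ℤ) ∣ b := eb ▸ hlb'.mul_left _
    have hlq : (l : ℤ) ∣ q := by
      rw [← h1]
      refine Finset.dvd_sum fun u _ => ?_
      rcases hw u with h | h | h <;> rw [h]
      · simp
      · exact hla
      · exact hlb
    have hu : IsUnit (l : ℤ) := (ca.pow_left (m := n)).isUnit_of_dvd' hlq hla'
    rw [Int.isUnit_iff] at hu
    have := hl.two_le
    omega
  have hcop_aL : IsCoprime a' L := by
    have e : (p : ℤ) ^ γ * L = -(p ^ β * b') + a' * p ^ α := by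
      linear_combination ea - eb - eL
    have h0 : IsCoprime a' (-(p ^ β * b')) :=
      (IsCoprime.mul_right ca.symm.pow_right hcop_ab).neg_right
    have h1 := h0.add_mul_left_right ((p : ℤ) ^ α)
    rw [← e] at h1
    exact h1.of_mul_right_right
  have hcop_bL : IsCoprime b' L := by
    have e : (p : ℤ) ^ γ * L = p ^ α * a' + b' * (-p ^ β) := by
      linear_combination ea - eb - eL
    have h0 : IsCoprime b' (p ^ α * a') :=
      (IsCoprime.mul_right cb.symm.pow_right hcop_ab.symm)
    have h1 := h0.add_mul_left_right (-(p : ℤ) ^ β)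
    rw [← e] at h1
    exact h1.of_mul_right_right
  have hdvd : ∀ v, v ≠ 1 → a' * b' * L ∣ M v := by
    intro v hv
    have d1 := hdiv a b hw v hv
    have d2 := hdiv b a (fun u => by rcases hw u with h | h | h <;> simp [h]) v hv
    have ca' : a' ∣ (M v : ℤ) := by
      refine IsCoprime.dvd_of_dvd_mul_left (z := (M v : ℤ)) (y := q ^ 2) ?_ ?_
      · rw [hq, ← pow_mul]; exact ca.symm.pow_right
      · exact ((Dvd.intro_left _ ea.symm).trans (Dvd.intro _ rfl)).trans d1
    have cb' : b' ∣ (M v : ℤ) := by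
      refine IsCoprime.dvd_of_dvd_mul_left (z := (M v : ℤ)) (y := q ^ 2) ?_ ?_
      · rw [hq, ← pow_mul]; exact cb.symm.pow_right
      · exact ((Dvd.intro_left _ eb.symm).trans (Dvd.intro _ rfl)).trans d2
    have cL' : L ∣ (M v : ℤ) := by
      refine IsCoprime.dvd_of_dvd_mul_left (z := (M v : ℤ)) (y := q ^ 2) ?_ ?_
      · rw [hq, ← pow_mul]; exact cL.symm.pow_right
      · exact ((Dvd.intro_left _ eL.symm).trans (Dvd.intro_left _ rfl)).trans d1
    exact (IsCoprime.mul_left hcop_aL hcop_bL).mul_dvd (hcop_ab.mul_dvd ca' cb') cL'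
  have hle : |a' * b' * L| * X ≤ Y := by
    rw [hX, hY, Finset.mul_sum]
    refine Finset.sum_le_sum fun v hv => ?_
    have hv1 := Finset.ne_of_mem_erase hv
    rcases Nat.eq_zero_or_pos (M v) with h0 | h0
    · simp [h0]
    · have h0' : (0 : ℤ) < M v := by exact_mod_cast h0
      have := Int.le_of_dvd h0' ((abs_dvd _ _).mpr (hdvd v hv1))
      nlinarith
  have hfin : |a' * b' * L| * q ≤ -(a * b) := by
    have : (|a' * b' * L| * q) * X ≤ -(a * b) * X := by
      rw [← hXY]
      calc |a' * b' * L| * q * X = q * (|a' * b' * L| * X) := by ring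
        _ ≤ q * Y := mul_le_mul_of_nonneg_left hle hq0.le
    exact le_of_mul_le_mul_right this hXpos
  have hab' : -(a * b) = p ^ (α + β) * |a' * b'| := by
    rw [← abs_of_neg habneg, ea, eb, show (p : ℤ) ^ α * a' * (p ^ β * b') = p ^ (α + β) * (a' * b') by ring,
      abs_mul, abs_of_pos (by positivity : (0 : ℤ) < p ^ (α + β))]
  have hpos : 0 < |a' * b'| := by
    rw [abs_pos]; rintro h
    rw [h, abs_zero, mul_zero] at hab'; omega
  rw [hab', abs_mul] at hfin
  refine le_of_mul_le_mul_left ?_ hpos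
  linarith

theorem exists_unit_part (p : ℕ) [hp : Fact p.Prime] (a : ℤ) (ha : a ≠ 0) :
    ∃ a' : ℤ, a = (p : ℤ) ^ padicValInt p a * a' ∧ IsCoprime (p : ℤ) a' := by
  obtain ⟨a', h⟩ := padicValInt_dvd (p := p) a
  refine ⟨a', h, ?_⟩
  rw [(Nat.prime_iff_prime_int.mp hp.out).coprime_iff_not_dvd]
  rintro ⟨c, rfl⟩
  have : (p : ℤ) ^ (padicValInt p a + 1) ∣ a := ⟨c, by rw [pow_succ, mul_assoc]; exact h⟩
  rw [padicValInt_dvd_iff] at this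
  rcases this with h | h
  · exact ha h
  · omega

/-- The case of distinct valuations. -/
theorem case_lt (p n : ℕ) [hp : Fact p.Prime] (a b : ℤ) (hab : a * b < 0)
    (H : ∀ a' b' L : ℤ, ∀ α β γ : ℕ, a = p ^ α * a' → b = p ^ β * b' → a - b = p ^ γ * L →
      IsCoprime (p : ℤ) a' → IsCoprime (p : ℤ) b' → IsCoprime (p : ℤ) L →
      |L| * (p : ℤ) ^ n ≤ p ^ (α + β))
    (hlt : padicValInt p a < padicValInt p b) : n < 2 * padicValInt p a := by
  have ha : a ≠ 0 := by rintro rfl; simp at hab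
  have hb : b ≠ 0 := by rintro rfl; simp at hab
  have hp1 : (1 : ℤ) < p := by exact_mod_cast hp.out.one_lt
  have hp0 : (0 : ℤ) < p := by linarith
  obtain ⟨a', ea, ca⟩ := exists_unit_part p a ha
  obtain ⟨b', eb, cb⟩ := exists_unit_part p b hb
  set α := padicValInt p a
  set β := padicValInt p b
  obtain ⟨k, hk⟩ := Nat.exists_eq_add_of_lt hlt
  have hk' : β = α + (k + 1) := by omega
  have ea'b' : a' * b' < 0 := by
    rw [ea, eb, show (p : ℤ) ^ α * a' * (p ^ β * b') = p ^ (α + β) * (a' * b') by ring] at hab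
    exact neg_of_mul_neg_right hab (by positivity)
  have cL : IsCoprime (p : ℤ) (a' - p ^ (k + 1) * b') := by
    have := ca.add_mul_left_right (-(p ^ k * b'))
    rwa [show a' + p * (-(p ^ k * b')) = a' - p ^ (k + 1) * b' by ring] at this
  have hle := H a' b' _ α β α ea eb (by
    calc a - b = p ^ α * a' - p ^ β * b' := by rw [← ea, ← eb]
      _ = _ := by rw [hk', pow_add]; ring) ca cb cL
  have hP : (0 : ℤ) < p ^ (k + 1) := by positivity
  have hL : (p : ℤ) ^ (k + 1) < |a' - p ^ (k + 1) * b'| := by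
    rcases mul_neg_iff.mp ea'b' with ⟨h1, h2⟩ | ⟨h1, h2⟩
    · refine lt_of_lt_of_le ?_ (le_abs_self _)
      nlinarith
    · refine lt_of_lt_of_le ?_ (neg_le_abs _)
      nlinarith
  have h3 : (p : ℤ) ^ (k + 1 + n) < p ^ (α + β) := by
    refine lt_of_lt_of_le ?_ hle
    rw [pow_add]
    exact mul_lt_mul_of_pos_right hL (by positivity)
  have := (pow_lt_pow_iff_right₀ hp1).mp h3
  omega

open scoped Classical in
theorem stmt_17 (p : ℕ) [Fact p.Prime] (F : Type*) [Field F] [Fintype F]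
    [Algebra (ZMod p) F] (n : ℕ) (hn : Fintype.card F = p ^ n)
    (d : ℕ) (hd : 0 < d) (hcop : Nat.Coprime d (Fintype.card F - 1))
    (a b : ℤ) (ha : a ≠ 0) (hb : b ≠ 0) (hab : a ≠ b)
    (hvals : (Set.range fun u : Fˣ => weilSum p F d u) = {0, (a : ℂ), (b : ℂ)}) :
    ((n < 2 * padicValInt p a ∧ n < 2 * padicValInt p b) ∨
      (n = 2 * padicValInt p a ∧ n = 2 * padicValInt p b ∧
        ∃ k : ℕ, (a - b).natAbs = p ^ k ∧ p ^ n < (p ^ k) ^ 2)) ∧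
    (p = 2 ∨ p = 3 → n < 2 * padicValInt p a ∧ n < 2 * padicValInt p b) := by
  have hp : p.Prime := Fact.out
  let e : AddChar F ℂ :=
    (ZMod.stdAddChar (N := p)).compAddMonoidHom (Algebra.trace (ZMod p) F).toAddMonoidHom
  have hepsi : ∀ x, psi p F x = e x := by
    intro x
    change _ = ZMod.stdAddChar (Algebra.trace (ZMod p) F x)
    have := ZMod.stdAddChar_coe (N := p) ((Algebra.trace (ZMod p) F x).val : ℤ)
    rw [Int.cast_natCast, Int.cast_natCast, ZMod.natCast_zmod_val] at this
    rw [this, psi]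
  have he : e.IsPrimitive := by
    apply AddChar.IsPrimitive.of_ne_one
    intro h
    apply Algebra.trace_ne_zero (ZMod p) F
    ext x
    have hx : ZMod.stdAddChar (Algebra.trace (ZMod p) F x) = 1 := by
      have := DFunLike.congr_fun h x
      exact this
    apply ZMod.injective_stdAddChar (N := p)
    rw [hx]; simp
  have hW : ∀ u, weilSum p F d u = WW e d u := by
    intro u
    simp only [weilSum, WW, hepsi]
  have hmem : ∀ u : Fˣ, ∃ z : ℤ, WW e d u = z ∧ (z = 0 ∨ z = a ∨ z = b) := by
    intro u
    have : WW e d u ∈ ({0, (a : ℂ), (b : ℂ)} : Set ℂ) := by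
      rw [← hvals, ← hW]; exact ⟨u, rfl⟩
    rcases this with h | h | h
    · exact ⟨0, by simpa using h, by simp⟩
    · exact ⟨a, h, by simp⟩
    · exact ⟨b, h, by simp⟩
  choose w hw hw' using hmem
  have hex : ∀ c : ℤ, (c : ℂ) ∈ ({0, (a : ℂ), (b : ℂ)} : Set ℂ) → ∃ u, w u = c := by
    intro c hc
    rw [← hvals] at hc
    obtain ⟨u, hu⟩ := hc
    refine ⟨u, ?_⟩
    have : (w u : ℂ) = c := by rw [← hw, ← hW]; exact hu
    exact_mod_cast this
  have hz := WW_zero e he d hd hcop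
  have hcard : (Fintype.card F : ℂ) = (p : ℂ) ^ n := by rw [hn]; push_cast; rfl
  have h1 : ∑ u, w u = (p : ℤ) ^ n := by
    have := WW_sum1 e he d hd
    rw [← sum_units_of_zero _ hz, hcard] at this
    simp_rw [hw] at this
    exact_mod_cast this
  have h2 : ∀ v, ∑ u, w u * w (v * u) = if v = 1 then ((p : ℤ) ^ n) ^ 2 else 0 := by
    intro v
    have := WW_sum2 e he d hd hcop (v : F)
    rw [← sum_units_of_zero _ (by simp [hz]), hcard] at this
    simp_rw [← Units.val_mul, hw, Units.val_eq_one] at this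
    split_ifs at this ⊢ <;> exact_mod_cast this
  have h3 : ∀ v : Fˣ, ∑ u, w u ^ 2 * w (v * u) = ((p : ℤ) ^ n) ^ 2 * (cnt F d (v : F) : ℕ) := by
    intro v
    have := WW_sum3 e he d hd hcop (v : F)
    rw [← sum_units_of_zero _ (by simp [hz]), hcard] at this
    simp_rw [← Units.val_mul, hw] at this
    exact_mod_cast this
  obtain ⟨hneg, hM1, H⟩ := core_w p n hp a b ha hb hab w (fun v : Fˣ => cnt F d (v : F)) hw'
    (hex a (by simp)) (hex b (by simp)) h1 h2 h3
  have H' : ∀ a' b' L : ℤ, ∀ α β γ : ℕ, b = p ^ α * a' → a = p ^ β * b' → b - a = p ^ γ * L →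
      IsCoprime (p : ℤ) a' → IsCoprime (p : ℤ) b' → IsCoprime (p : ℤ) L →
      |L| * (p : ℤ) ^ n ≤ p ^ (α + β) := by
    intro a' b' L α β γ i1 i2 i3 i4 i5 i6
    have := H b' a' (-L) β α γ i2 i1 (by linear_combination -i3) i5 i4 i6.neg_right
    rwa [abs_neg, add_comm] at this
  have hp1 : (1 : ℤ) < p := by exact_mod_cast hp.one_lt
  have hp0 : (0 : ℤ) < p := by linarith
  rcases lt_trichotomy (padicValInt p a) (padicValInt p b) with h | h | h
  · have := case_lt p n a b hneg H h
    have hh : n < 2 * padicValInt p a ∧ n < 2 * padicValInt p b := ⟨this, by omega⟩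
    exact ⟨Or.inl hh, fun _ => hh⟩
  · obtain ⟨a', ea, ca⟩ := exists_unit_part p a ha
    obtain ⟨b', eb, cb⟩ := exists_unit_part p b hb
    obtain ⟨L, eL, cL⟩ := exists_unit_part p (a - b) (sub_ne_zero.mpr hab)
    have hle := H a' b' L _ _ _ ea eb eL ca cb cL
    rw [← h] at eb hle ⊢
    set α := padicValInt p a
    set γ := padicValInt p (a - b)
    have hL0 : 0 < |L| := by
      rw [abs_pos]; rintro rfl
      apply hab; linear_combination eL
    have hle2 : (p : ℤ) ^ n ≤ p ^ (α + α) :=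
      le_trans (le_mul_of_one_le_left (by positivity) hL0) hle
    have hnα := (pow_le_pow_iff_right₀ hp1).mp hle2
    rcases Nat.lt_or_ge n (2 * α) with hlt | hge
    · exact ⟨Or.inl ⟨hlt, hlt⟩, fun _ => ⟨hlt, hlt⟩⟩
    have hnn : n = α + α := by omega
    have hn0 : n ≠ 0 := by
      rintro rfl
      have := Fintype.one_lt_card (α := F)
      rw [hn] at this; simp at this
    refine ⟨Or.inr ⟨by omega, by omega, γ, ?_, ?_⟩, ?_⟩
    · have hL1 : |L| = 1 := by
        rw [← hnn] at hle
        have : |L| ≤ 1 := le_of_mul_le_mul_right (by linarith) (by positivity : (0 : ℤ) < p ^ n)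
        omega
      have : |a - b| = p ^ γ := by
        rw [eL, abs_mul, hL1, mul_one, abs_of_pos (by positivity)]
      rw [Int.abs_eq_natAbs] at this
      exact_mod_cast this
    · have hL1 : |L| = 1 := by
        rw [← hnn] at hle
        have : |L| ≤ 1 := le_of_mul_le_mul_right (by linarith) (by positivity : (0 : ℤ) < p ^ n)
        omega
      have e1 : |a - b| = p ^ γ := by
        rw [eL, abs_mul, hL1, mul_one, abs_of_pos (by positivity)]
      have e2 : (p : ℤ) ^ n < (p ^ γ) ^ 2 := by
        rw [← e1, sq_abs]
        have : (p : ℤ) ^ n ≤ a ^ 2 := by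
          have ha' : a' ≠ 0 := by rintro rfl; simp at ea; exact ha ea
          have : 0 < a' ^ 2 := by positivity
          have e3 : a ^ 2 = p ^ n * a' ^ 2 := by rw [ea, hnn]; ring
          rw [e3]
          exact le_mul_of_one_le_right (by positivity) this
        nlinarith [sq_nonneg b]
      exact_mod_cast e2
    · intro hp23
      exfalso
      have hdvd : (p : ℤ) ∣ (cnt F d 1 : ℕ) := by
        have : CharP F p := charP_of_injective_algebraMap (algebraMap (ZMod p) F).injective p
        have hc := CharP.cast_eq_zero F p
        rcases hp23 with rfl | rfl
        · exact_mod_cast cnt_two (F := F) (by exact_mod_cast hc) d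
        · exact_mod_cast cnt_three (F := F) (by exact_mod_cast hc) (by rw [hn]; exact dvd_pow_self _ hn0) d hd hcop
      have hα : α ≠ 0 := by omega
      have hpa : (p : ℤ) ∣ a := by rw [ea]; exact (dvd_pow_self _ hα).mul_right _
      have hpb : (p : ℤ) ∣ b := by rw [eb]; exact (dvd_pow_self _ hα).mul_right _
      have hM : (cnt F d 1 : ℤ) = a + b - a' * b' := by
        have hpn : (p : ℤ) ^ n ≠ 0 := by positivity
        apply mul_left_cancel₀ hpn
        simp only [Units.val_one] at hM1
        have : a * b = p ^ n * (a' * b') := by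
          conv_lhs => rw [ea, eb]
          rw [hnn]; ring
        rw [hM1, this]; ring
      have hpab : (p : ℤ) ∣ a' * b' := by
        have : a' * b' = a + b - (cnt F d 1 : ℕ) := by rw [hM]; ring
        rw [this]
        exact dvd_sub (dvd_add hpa hpb) hdvd
      have hu : IsUnit (p : ℤ) := (ca.mul_right cb).isUnit_of_dvd' dvd_rfl hpab
      rw [Int.isUnit_iff] at hu
      omega
  · have := case_lt p n b a (by rwa [mul_comm]) H' h
    have hh : n < 2 * padicValInt p a ∧ n < 2 * padicValInt p b := ⟨by omega, this⟩
    exact ⟨Or.inl hh, fun _ => hh⟩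
end

section
/- Let F be a finite field of characteristic p and order q = p^n with n a power of 2, and let d be a positive integer with gcd(d, q−1) = 1 such that W_{F,d} takes exactly three values on F*. Then there exists u ∈ F* with v_p(W_{F,d}(u)) ≤ n/2. -/
open Complex

section Basics

variable (p : ℕ) [Fact p.Prime] (F : Type*) [Field F] [Fintype F] [Algebra (ZMod p) F]

lemma psi_eq (x : F) : psi p F x = ZMod.stdAddChar (Algebra.trace (ZMod p) F x) := by
  rw [psi, ZMod.stdAddChar_apply, ZMod.toCircle_apply]

lemma psi_zero : psi p F 0 = 1 := by simp [psi_eq]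

lemma psi_add (x y : F) : psi p F (x + y) = psi p F x * psi p F y := by
  simp [psi_eq, AddChar.map_add_eq_mul]

lemma psi_pow_p (x : F) : psi p F x ^ p = 1 := by
  rw [psi_eq, ← AddChar.map_nsmul_eq_pow]
  simp

lemma psi_eq_one_iff (x : F) : psi p F x = 1 ↔ Algebra.trace (ZMod p) F x = 0 := by
  rw [psi_eq]
  constructor
  · intro h
    apply ZMod.injective_stdAddChar
    rw [h, AddChar.map_zero_eq_one]
  · intro h
    rw [h, AddChar.map_zero_eq_one]

/-- The canonical character as an `AddChar`. -/
noncomputable def chi : AddChar F ℂ where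
  toFun := psi p F
  map_zero_eq_one' := psi_zero p F
  map_add_eq_mul' := psi_add p F

lemma chi_apply (x : F) : chi p F x = psi p F x := rfl

lemma exists_trace_ne (a : F) (ha : a ≠ 0) : ∃ b : F, Algebra.trace (ZMod p) F (a * b) ≠ 0 := by
  have htr := (traceForm_nondegenerate (ZMod p) F).1 a
  simp_rw [Algebra.traceForm_apply] at htr
  by_contra! hf
  exact ha (htr hf)

open scoped Classical in
lemma sum_psi_mul (a : F) :
    ∑ x : F, psi p F (a * x) = if a = 0 then (Fintype.card F : ℂ) else 0 := by
  have h := AddChar.sum_eq_ite ((chi p F).mulShift a)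
  have h2 : (chi p F).mulShift a = 0 ↔ a = 0 := by
    constructor
    · intro h
      by_contra ha
      obtain ⟨b, hb⟩ := exists_trace_ne p F a ha
      apply hb
      rw [← psi_eq_one_iff]
      have := DFunLike.congr_fun h b
      simpa [AddChar.mulShift_apply, chi_apply] using this
    · rintro rfl
      ext x
      simp
  simp only [h2] at h
  rw [← h]
  rfl

lemma psi_isIntegral (x : F) : IsIntegral ℤ (psi p F x) := by
  apply IsIntegral.of_pow (Fact.out : p.Prime).pos
  rw [psi_pow_p]
  exact isIntegral_one

lemma weil_isIntegral (d : ℕ) (u : F) : IsIntegral ℤ (weilSum p F d u) :=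
  IsIntegral.sum _ fun _ _ => psi_isIntegral p F _

lemma int_of_integral_rat (z : ℂ) (hz : IsIntegral ℤ z) (a b : ℤ) (hb : b ≠ 0)
    (h : (b : ℂ) * z = a) : ∃ m : ℤ, z = m := by
  have hz2 : z = algebraMap ℚ ℂ ((a : ℚ) / b) := by
    have : (b : ℂ) ≠ 0 := by exact_mod_cast hb
    simp only [eq_ratCast, Rat.cast_div, Rat.cast_intCast]
    field_simp
    linear_combination h
  rw [hz2] at hz
  have h3 : IsIntegral ℤ ((a : ℚ) / b) := by
    rwa [isIntegral_algebraMap_iff (algebraMap ℚ ℂ).injective] at hz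
  obtain ⟨m, hm⟩ := IsIntegrallyClosed.isIntegral_iff.1 h3
  refine ⟨m, ?_⟩
  rw [hz2, ← hm]
  simp

variable {F} in
lemma pow_d_injective (d : ℕ) (hd : 0 < d) (hcop : Nat.Coprime d (Fintype.card F - 1)) :
    Function.Injective fun x : F => x ^ d := by
  classical
  intro x y h
  simp only at h
  by_cases hx : x = 0
  · subst hx
    rw [zero_pow hd.ne'] at h
    exact (pow_eq_zero_iff hd.ne' |>.1 h.symm).symm
  · have hy : y ≠ 0 := by
      rintro rfl
      rw [zero_pow hd.ne'] at h
      exact hx (pow_eq_zero_iff hd.ne' |>.1 h)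
    have hc : (Nat.card Fˣ).Coprime d := by
      rw [Nat.card_eq_fintype_card, Fintype.card_units]
      exact hcop.symm
    have hb := (hc.pow_left_bijective).1
    have := @hb (Units.mk0 x hx) (Units.mk0 y hy) (by ext; simpa using h)
    simpa using congrArg Units.val this

variable {F} in
lemma pow_d_bijective (d : ℕ) (hd : 0 < d) (hcop : Nat.Coprime d (Fintype.card F - 1)) :
    Function.Bijective fun x : F => x ^ d :=
  Finite.injective_iff_bijective.1 (pow_d_injective d hd hcop)

variable {F} in
lemma neg_one_pow_d (d : ℕ) (hcop : Nat.Coprime d (Fintype.card F - 1)) : (-1 : F) ^ d = -1 := by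
  rcases Nat.even_or_odd d with h | h
  · have h1 : (-1 : F) ^ d = 1 := h.neg_one_pow
    rw [h1]
    have h2 : (-1 : F) ^ (Fintype.card F - 1) = 1 :=
      FiniteField.pow_card_sub_one_eq_one _ (by simp)
    have h3 : orderOf (-1 : F) ∣ Nat.gcd d (Fintype.card F - 1) :=
      Nat.dvd_gcd (orderOf_dvd_of_pow_eq_one h1) (orderOf_dvd_of_pow_eq_one h2)
    rw [hcop] at h3
    have := orderOf_eq_one_iff.1 (Nat.dvd_one.1 h3)
    exact this.symm
  · exact h.neg_one_pow

open scoped Classical in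
lemma sum_psi_mul_pow (d : ℕ) (hd : 0 < d) (hcop : Nat.Coprime d (Fintype.card F - 1)) (a : F) :
    ∑ x : F, psi p F (a * x ^ d) = if a = 0 then (Fintype.card F : ℂ) else 0 := by
  rw [← sum_psi_mul p F]
  exact (pow_d_bijective d hd hcop).sum_comp (fun y => psi p F (a * y))

lemma weil_zero (d : ℕ) (hd : 0 < d) (hcop : Nat.Coprime d (Fintype.card F - 1)) :
    weilSum p F d 0 = 0 := by
  classical
  have := sum_psi_mul_pow p F d hd hcop 1
  simpa [weilSum] using this

lemma sum_weil (d : ℕ) (hd : 0 < d) :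
    ∑ u : F, weilSum p F d u = Fintype.card F := by
  classical
  unfold weilSum
  rw [Finset.sum_comm]
  have : ∀ x : F, ∑ u : F, psi p F (x ^ d + u * x) =
      if x = 0 then (Fintype.card F : ℂ) else 0 := by
    intro x
    simp_rw [psi_add]
    rw [← Finset.mul_sum]
    have := sum_psi_mul p F x
    simp_rw [mul_comm x] at this
    rw [this]
    split_ifs with h
    · simp [h, hd.ne', psi_zero]
    · simp
  simp_rw [this]
  simp

open scoped Classical in
lemma sum_weil_mul (d : ℕ) (hd : 0 < d) (hcop : Nat.Coprime d (Fintype.card F - 1)) (l : F) :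
    ∑ u : F, weilSum p F d u * weilSum p F d (l * u) =
      if l = 1 then (Fintype.card F : ℂ) ^ 2 else 0 := by
  have h1 : ∀ u : F, weilSum p F d u * weilSum p F d (l * u) =
      ∑ y : F, ∑ x : F, psi p F (x ^ d + y ^ d) * psi p F ((x + l * y) * u) := by
    intro u
    unfold weilSum
    rw [Finset.sum_mul_sum, Finset.sum_comm]
    refine Finset.sum_congr rfl fun y _ => Finset.sum_congr rfl fun x _ => ?_
    rw [← psi_add, ← psi_add]
    congr 1
    ring
  simp_rw [h1]
  rw [Finset.sum_comm]
  have h2 : ∀ y : F, ∑ u : F, ∑ x : F, psi p F (x ^ d + y ^ d) * psi p F ((x + l * y) * u) =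
      Fintype.card F * psi p F (((-l) ^ d + 1) * y ^ d) := by
    intro y
    rw [Finset.sum_comm]
    simp_rw [← Finset.mul_sum, sum_psi_mul]
    rw [Finset.sum_eq_single (-(l * y))]
    · simp only [neg_add_cancel, if_true]
      rw [mul_comm]
      congr 2
      rw [← neg_mul, mul_pow]; ring
    · intro x _ hx
      rw [if_neg, mul_zero]
      intro h
      exact hx (eq_neg_of_add_eq_zero_left h)
    · simp
  simp_rw [h2]
  rw [← Finset.mul_sum, sum_psi_mul_pow p F d hd hcop]
  have h3 : (-l) ^ d + 1 = 0 ↔ l = 1 := by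
    rw [add_eq_zero_iff_eq_neg]
    have h4 := (pow_d_injective d hd hcop).eq_iff (a := -l) (b := -1)
    simp only [neg_one_pow_d d hcop] at h4
    rw [h4, neg_inj]
  rw [h3]
  split_ifs <;> ring

lemma pow_mod_eq {z : ℂ} {p : ℕ} (h : z ^ p = 1) (a : ℕ) : z ^ (a % p) = z ^ a := by
  conv_rhs => rw [← Nat.mod_add_div a p, pow_add, pow_mul, h, one_pow, mul_one]

/-- Galois conjugates of the Weil sum. -/
noncomputable def tw (d : ℕ) (c : ZMod p) (u : F) : ℂ :=
  ∑ x : F, psi p F (algebraMap (ZMod p) F c * (x ^ d + u * x))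

lemma psi_algebraMap_mul (c : ZMod p) (x : F) :
    psi p F (algebraMap (ZMod p) F c * x) =
      ZMod.stdAddChar (c * Algebra.trace (ZMod p) F x) := by
  rw [psi_eq, ← Algebra.smul_def, map_smul, smul_eq_mul]

lemma int_of_tw (d : ℕ) (u : F) (h : ∀ c : ZMod p, c ≠ 0 → tw p F d c u = weilSum p F d u) :
    ∃ m : ℤ, weilSum p F d u = m := by
  classical
  have hp : p.Prime := Fact.out
  have h1 : ∑ c : ZMod p, tw p F d c u =
      ((∑ x : F, if Algebra.trace (ZMod p) F (x ^ d + u * x) = 0 then p else 0 : ℕ) : ℂ) := by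
    unfold tw
    rw [Finset.sum_comm, Nat.cast_sum]
    refine Finset.sum_congr rfl fun x _ => ?_
    simp_rw [psi_algebraMap_mul]
    have := AddChar.sum_mulShift (Algebra.trace (ZMod p) F (x ^ d + u * x))
      (ZMod.isPrimitive_stdAddChar p)
    rw [this]
    split_ifs <;> simp [ZMod.card]
  have h2 : ∑ c : ZMod p, tw p F d c u = Fintype.card F + (p - 1) * weilSum p F d u := by
    rw [← Finset.add_sum_erase _ _ (Finset.mem_univ (0 : ZMod p))]
    rw [Finset.sum_congr rfl (fun c hc => h c (Finset.ne_of_mem_erase hc))]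
    rw [Finset.sum_const, Finset.card_erase_of_mem (Finset.mem_univ _), Finset.card_univ, ZMod.card]
    simp [tw, psi_zero, Nat.cast_sub hp.one_le]
  rw [h1] at h2
  refine int_of_integral_rat _ (weil_isIntegral p F d u)
    ((∑ x : F, if Algebra.trace (ZMod p) F (x ^ d + u * x) = 0 then p else 0 : ℕ) - Fintype.card F)
    (p - 1) ?_ ?_
  · have := hp.two_le
    omega
  · push_cast at h2 ⊢
    linear_combination -h2

lemma tw_eq (d : ℕ) (b l : ZMod p) (hb : b ≠ 0) (hl : l * b = b ^ d) (u : F) :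
    tw p F d (b ^ d) u = weilSum p F d (algebraMap (ZMod p) F l * u) := by
  unfold tw weilSum
  have hb' : algebraMap (ZMod p) F b ≠ 0 := by simpa using hb
  rw [← (mulLeft_bijective₀ _ hb').sum_comp
    (fun y => psi p F (y ^ d + algebraMap (ZMod p) F l * u * y))]
  refine Finset.sum_congr rfl fun x _ => ?_
  congr 1
  have hl' := congrArg (algebraMap (ZMod p) F) hl
  rw [map_mul, map_pow] at hl'
  rw [map_pow, mul_pow]
  linear_combination -(u * x) * hl'

lemma tw_galois (d : ℕ) (u v : F) (h : weilSum p F d u = weilSum p F d v) (c : ZMod p)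
    (hc : c ≠ 0) : tw p F d c u = tw p F d c v := by
  have hp : p.Prime := Fact.out
  let ζ : ℂ := ZMod.stdAddChar (1 : ZMod p)
  have hζp : ∀ a : ZMod p, ZMod.stdAddChar a = ζ ^ a.val := by
    intro a
    rw [← AddChar.map_nsmul_eq_pow]
    simp
  have hζ : IsPrimitiveRoot ζ p := by
    have := Complex.isPrimitiveRoot_exp p hp.ne_zero
    have h2 : ζ = Complex.exp (2 * Real.pi * Complex.I / p) := by
      have := ZMod.stdAddChar_coe (N := p) 1
      simpa [ζ] using this
    rwa [h2]
  let P : F → Polynomial ℤ := fun u =>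
    ∑ x : F, Polynomial.X ^ (Algebra.trace (ZMod p) F (x ^ d + u * x)).val
  have hP1 : ∀ u, Polynomial.aeval ζ (P u) = weilSum p F d u := by
    intro u
    simp [P, weilSum, psi_eq, hζp]
  have hP2 : ∀ u, Polynomial.aeval (ζ ^ c.val) (P u) = tw p F d c u := by
    intro u
    simp only [P, tw, map_sum, map_pow, Polynomial.aeval_X]
    refine Finset.sum_congr rfl fun x _ => ?_
    rw [psi_algebraMap_mul, ← pow_mul, hζp]
    rw [ZMod.val_mul, pow_mod_eq hζ.pow_eq_one]
  have hcop : Nat.Coprime c.val p := by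
    rw [Nat.coprime_comm, hp.coprime_iff_not_dvd]
    intro h
    exact hc ((ZMod.val_eq_zero c).1 (Nat.eq_zero_of_dvd_of_lt h (ZMod.val_lt c)))
  have hdvd : minpoly ℤ ζ ∣ P u - P v := by
    apply minpoly.isIntegrallyClosed_dvd (hζ.isIntegral hp.pos)
    rw [map_sub, hP1, hP1, h, sub_self]
  rw [hζ.minpoly_eq_pow_coprime hcop] at hdvd
  have h0 : Polynomial.aeval (ζ ^ c.val) (P u - P v) = 0 := by
    obtain ⟨Q, hQ⟩ := hdvd
    rw [hQ, map_mul, minpoly.aeval, zero_mul]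
  rw [map_sub, hP2, hP2] at h0
  exact sub_eq_zero.1 h0

end Basics
section Niho

/-- `x ↦ x ^ d` is additive on `F` (i.e. `d` is degenerate over `F`). -/
def Addv (d : ℕ) (F : Type*) [Field F] : Prop := ∀ x y : F, (x + y) ^ d = x ^ d + y ^ d

variable (p : ℕ) [Fact p.Prime] (F : Type*) [Field F] [Fintype F] [Algebra (ZMod p) F]

lemma int_of_hd1 (d : ℕ) (hd1 : ∀ b : ZMod p, b ^ d = b) (u : F) :
    ∃ m : ℤ, weilSum p F d u = m := by
  apply int_of_tw
  intro c hc
  have := tw_eq p F d c 1 hc (by rw [hd1, one_mul]) u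
  rwa [hd1, map_one, one_mul] at this

lemma niho_ge (K : Type*) [Field K] [Fintype K] [Algebra K F]
    (hcard : Fintype.card F = Fintype.card K ^ 2) (d : ℕ) (hd : 0 < d) (hadd : Addv d K) (u : F)
    (m : ℤ) (hm : weilSum p F d u = m) : -(Fintype.card K : ℤ) ≤ m := by
  classical
  let f : F → ℂ := fun x => psi p F (x ^ d + u * x)
  have h1 : ∑ c : K, ∑ x : F, f (algebraMap K F c * x) =
      Fintype.card F + (Fintype.card K - 1) * m := by
    rw [← Finset.add_sum_erase _ _ (Finset.mem_univ (0 : K))]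
    have : ∀ c ∈ Finset.univ.erase (0 : K), ∑ x : F, f (algebraMap K F c * x) = m := by
      intro c hc
      have hc' : algebraMap K F c ≠ 0 := by simpa using Finset.ne_of_mem_erase hc
      rw [(mulLeft_bijective₀ _ hc').sum_comp f, ← hm]
      rfl
    rw [Finset.sum_congr rfl this, Finset.sum_const, Finset.card_erase_of_mem (Finset.mem_univ _),
      Finset.card_univ]
    simp [f, psi_zero, hd.ne', Nat.cast_sub Fintype.card_pos]
  have h2 : ∀ x : F, ∃ e : ℕ, ∑ c : K, f (algebraMap K F c * x) = e := by
    intro x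
    let g : AddChar K ℂ :=
      { toFun := fun c => f (algebraMap K F c * x)
        map_zero_eq_one' := by simp [f, psi_zero, hd.ne']
        map_add_eq_mul' := by
          intro a b
          simp only [f]
          rw [← psi_add]
          congr 1
          have := congrArg (algebraMap K F) (hadd a b)
          simp only [map_add, map_pow] at this
          rw [map_add, mul_pow, this]
          ring }
    have := AddChar.sum_eq_ite g
    refine ⟨if g = 0 then Fintype.card K else 0, ?_⟩
    change ∑ c : K, g c = _
    rw [this]
    split_ifs <;> simp
  choose e he using h2
  have he0 : e 0 = Fintype.card K := by
    have := he 0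
    simp [f, psi_zero, hd.ne'] at this
    exact_mod_cast this.symm
  rw [Finset.sum_comm] at h1
  simp_rw [he] at h1
  have h3 : (∑ x : F, (e x : ℤ)) = Fintype.card F + (Fintype.card K - 1) * m := by
    exact_mod_cast h1
  have h4 : (e 0 : ℤ) ≤ ∑ x : F, (e x : ℤ) :=
    Finset.single_le_sum (f := fun x => (e x : ℤ)) (fun _ _ => by positivity) (Finset.mem_univ 0)
  rw [h3, he0, hcard] at h4
  have h5 : 1 < Fintype.card K := Fintype.one_lt_card
  have h5' : (1 : ℤ) < Fintype.card K := by exact_mod_cast h5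
  push_cast at h4
  nlinarith

lemma addv_of_nonneg (d : ℕ) (hd : 0 < d) (hcop : Nat.Coprime d (Fintype.card F - 1))
    (m : F → ℤ) (hm : ∀ u, weilSum p F d u = m u) (h0 : ∀ u, 0 ≤ m u) : Addv d F := by
  classical
  have hs1 : ∑ u, m u = Fintype.card F := by
    have := sum_weil p F d hd
    simp_rw [hm] at this
    exact_mod_cast this
  have hs2 : ∑ u, m u * m u = (Fintype.card F : ℤ) ^ 2 := by
    have := sum_weil_mul p F d hd hcop 1
    simp only [one_mul, if_true] at this
    simp_rw [hm] at this
    exact_mod_cast this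
  have hle : ∀ u, m u ≤ Fintype.card F := by
    intro u
    rw [← hs1]
    exact Finset.single_le_sum (fun _ _ => h0 _) (Finset.mem_univ u)
  have hz : ∑ u, m u * (Fintype.card F - m u) = 0 := by
    simp_rw [mul_sub]
    rw [Finset.sum_sub_distrib, ← Finset.sum_mul, hs1, hs2]
    ring
  have hz2 := (Finset.sum_eq_zero_iff_of_nonneg
    (fun u _ => mul_nonneg (h0 u) (sub_nonneg.2 (hle u)))).1 hz
  obtain ⟨u, hu⟩ : ∃ u, m u ≠ 0 := by
    by_contra! h
    simp only [h, Finset.sum_const_zero] at hs1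
    have := Fintype.card_pos (α := F)
    omega
  have hmu : m u = Fintype.card F := by
    rcases mul_eq_zero.1 (hz2 u (Finset.mem_univ _)) with h | h
    · exact absurd h hu
    · linarith
  have hnorm : ∀ x, ‖psi p F x‖ = 1 := fun x =>
    Complex.norm_eq_one_of_pow_eq_one (psi_pow_p p F x) (Fact.out : p.Prime).ne_zero
  have hre : ∑ x : F, (1 - (psi p F (x ^ d + u * x)).re) = 0 := by
    rw [Finset.sum_sub_distrib, ← Complex.re_sum]
    have := hm u
    rw [weilSum, hmu] at this
    rw [this]
    simp
  have hre2 := (Finset.sum_eq_zero_iff_of_nonneg (fun x _ => by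
    have h1 := Complex.re_le_norm (psi p F (x ^ d + u * x))
    rw [hnorm] at h1
    linarith)).1 hre
  have htr : ∀ x : F, Algebra.trace (ZMod p) F (x ^ d + u * x) = 0 := by
    intro x
    rw [← psi_eq_one_iff]
    have h1 := hre2 x (Finset.mem_univ _)
    have h2 := hnorm (x ^ d + u * x)
    have h3 := Complex.sq_norm (psi p F (x ^ d + u * x))
    rw [h2, Complex.normSq_apply] at h3
    have h4 : (psi p F (x ^ d + u * x)).re = 1 := by linarith
    rw [h4] at h3
    apply Complex.ext
    · simpa using h4
    · have : (psi p F (x ^ d + u * x)).im * (psi p F (x ^ d + u * x)).im = 0 := by linarith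
      simpa using this
  intro x y
  by_contra hne
  have hne' : (x + y) ^ d - (x ^ d + y ^ d) ≠ 0 := sub_ne_zero.2 hne
  obtain ⟨b, hb⟩ := exists_trace_ne p F _ hne'
  obtain ⟨c, rfl⟩ := (pow_d_bijective d hd hcop).2 b
  apply hb
  have e1 := htr (c * (x + y))
  have e2 := htr (c * x)
  have e3 := htr (c * y)
  have e4 : ((x + y) ^ d - (x ^ d + y ^ d)) * c ^ d =
      ((c * (x + y)) ^ d + u * (c * (x + y))) - ((c * x) ^ d + u * (c * x))
        - ((c * y) ^ d + u * (c * y)) := by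
    rw [mul_pow, mul_pow, mul_pow]
    ring
  simp only []
  rw [e4, map_sub, map_sub, e1, e2, e3]
  simp

lemma not_addv (d : ℕ) (hd : 0 < d) (hd1 : ∀ b : ZMod p, b ^ d = b)
    (h3 : (Set.range fun u : Fˣ => weilSum p F d u).ncard = 3) : ¬ Addv d F := by
  classical
  intro hadd
  let φ : F →ₐ[ZMod p] F :=
    { toFun := fun x => x ^ d
      map_one' := one_pow d
      map_mul' := fun x y => mul_pow x y d
      map_zero' := zero_pow hd.ne'
      map_add' := hadd
      commutes' := fun b => by rw [← map_pow, hd1] }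
  have hφ : Function.Bijective φ := Finite.injective_iff_bijective.1 φ.toRingHom.injective
  have htr : ∀ x : F, Algebra.trace (ZMod p) F (x ^ d) = Algebra.trace (ZMod p) F x := by
    intro x
    exact Algebra.trace_eq_of_algEquiv (AlgEquiv.ofBijective φ hφ) x
  have hW : ∀ u : F, weilSum p F d u = if 1 + u = 0 then (Fintype.card F : ℂ) else 0 := by
    intro u
    rw [← sum_psi_mul p F, weilSum]
    refine Finset.sum_congr rfl fun x _ => ?_
    rw [psi_eq, psi_eq, map_add, htr, ← map_add, add_mul, one_mul]
  have hsub : (Set.range fun u : Fˣ => weilSum p F d u) ⊆ {(Fintype.card F : ℂ), 0} := by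
    rintro _ ⟨u, rfl⟩
    simp only [hW]
    split_ifs <;> simp
  have := Set.ncard_le_ncard hsub (by simp)
  have h2 := Set.ncard_insert_le (Fintype.card F : ℂ) {0}
  rw [Set.ncard_singleton] at h2
  omega

end Niho
section GroupRing

open MonoidAlgebra

lemma groupRing_dvd_iff {G : Type*} [CommGroup G] (n : ℤ) (z : MonoidAlgebra ℤ G) :
    ((n : MonoidAlgebra ℤ G) ∣ z) ↔ ∀ g, n ∣ z.coeff g := by
  constructor
  · rintro ⟨y, rfl⟩ g
    rw [MonoidAlgebra.intCast_def, MonoidAlgebra.coeff_single_one_mul]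
    simp
  · intro h
    choose f hf using h
    refine ⟨∑ g ∈ z.coeff.support, MonoidAlgebra.single g (f g), ?_⟩
    rw [Finset.mul_sum]
    conv_lhs => rw [← MonoidAlgebra.sum_coeff_single z]
    rw [Finsupp.sum]
    refine Finset.sum_congr rfl fun g _ => ?_
    rw [MonoidAlgebra.intCast_def, MonoidAlgebra.single_mul_single, one_mul, hf]
    simp

lemma groupRing_prime (p : ℕ) [Fact p.Prime] {G : Type*} [CommGroup G] (k : ℕ) (hk : 1 ≤ k)
    (hG : ∀ g : G, g ^ (p ^ k) = g) (z : MonoidAlgebra ℤ G)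
    (h : ((p : ℤ) : MonoidAlgebra ℤ G) ∣ z ^ 2) : ((p : ℤ) : MonoidAlgebra ℤ G) ∣ z := by
  have hp : p.Prime := Fact.out
  let φ := MonoidAlgebra.mapRingHom G (Int.castRingHom (ZMod p))
  have hφ : φ z ^ 2 = 0 := by
    obtain ⟨y, hy⟩ := h
    rw [← map_pow, hy, map_mul, map_intCast]
    have : (((p : ℤ) : MonoidAlgebra (ZMod p) G)) = 0 := by
      rw [MonoidAlgebra.intCast_def]
      simp
    rw [this, zero_mul]
  have : CharP (MonoidAlgebra (ZMod p) G) p := by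
    apply charP_of_injective_ringHom (f := MonoidAlgebra.singleOneRingHom (R := ZMod p) (M := G))
    exact MonoidAlgebra.single_right_injective
  have hfrob : φ z ^ (p ^ k) = φ z := by
    conv_lhs => rw [← MonoidAlgebra.sum_coeff_single (φ z)]
    conv_rhs => rw [← MonoidAlgebra.sum_coeff_single (φ z)]
    rw [Finsupp.sum, sum_pow_char_pow]
    refine Finset.sum_congr rfl fun g _ => ?_
    rw [MonoidAlgebra.single_pow, hG, ZMod.pow_card_pow]
  have hφ0 : φ z = 0 := by
    rw [← hfrob]
    have h2 : 2 ≤ p ^ k := le_trans hp.two_le (Nat.le_self_pow (by omega) p)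
    obtain ⟨t, ht⟩ := Nat.exists_eq_add_of_le h2
    rw [ht, pow_add, hφ, zero_mul]
  rw [groupRing_dvd_iff]
  intro g
  have := MonoidAlgebra.coeff_mapRingHom (Int.castRingHom (ZMod p)) z g
  change (φ z).coeff g = _ at this
  rw [hφ0] at this
  rw [← ZMod.intCast_zmod_eq_zero_iff_dvd]
  simpa using this.symm

lemma groupRing_sq (p : ℕ) [Fact p.Prime] {G : Type*} [CommGroup G] (k : ℕ) (hk : 1 ≤ k)
    (hG : ∀ g : G, g ^ (p ^ k) = g) (e : ℕ) : ∀ (z : MonoidAlgebra ℤ G),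
    (((p : ℤ) ^ (2 * e + 1) : ℤ) : MonoidAlgebra ℤ G) ∣ z ^ 2 →
      (((p : ℤ) ^ (e + 1) : ℤ) : MonoidAlgebra ℤ G) ∣ z := by
  have hp : p.Prime := Fact.out
  have hp0 : ∀ x : MonoidAlgebra ℤ G, ((p : ℤ) : MonoidAlgebra ℤ G) * x = 0 → x = 0 := by
    intro x hx
    ext g
    have := congrArg (fun y => MonoidAlgebra.coeff y g) hx
    simp only [MonoidAlgebra.intCast_def, MonoidAlgebra.coeff_single_one_mul] at this
    have hp' : (p : ℤ) ≠ 0 := by exact_mod_cast hp.ne_zero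
    simpa [hp.ne_zero] using this
  induction e with
  | zero =>
    intro z h
    simpa using groupRing_prime p k hk hG z (by simpa using h)
  | succ e ih =>
    intro z h
    have h1 : ((p : ℤ) : MonoidAlgebra ℤ G) ∣ z := by
      apply groupRing_prime p k hk hG
      refine dvd_trans ?_ h
      push_cast
      exact dvd_pow_self _ (by omega)
    obtain ⟨y, rfl⟩ := h1
    obtain ⟨t, ht⟩ := h
    have h2 : (((p : ℤ) ^ (e + 1) : ℤ) : MonoidAlgebra ℤ G) ∣ y := by
      apply ih
      refine ⟨t, ?_⟩
      have h3 := hp0 _ (show ((p : ℤ) : MonoidAlgebra ℤ G) * (((p : ℤ) : MonoidAlgebra ℤ G) *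
        (y ^ 2 - (((p : ℤ) ^ (2 * e + 1) : ℤ) : MonoidAlgebra ℤ G) * t)) = 0 by
          push_cast at ht ⊢
          linear_combination ht)
      exact sub_eq_zero.1 (hp0 _ h3)
    obtain ⟨s, rfl⟩ := h2
    refine ⟨s, ?_⟩
    push_cast
    ring

end GroupRing
section HD

variable (K L : Type*) [Field K] [Fintype K] [Field L] [Fintype L] [Algebra K L]

lemma trace_two (h2 : Module.finrank K L = 2) (x : L) :
    algebraMap K L (Algebra.trace K L x) = x + x ^ Fintype.card K := by
  rw [FiniteField.algebraMap_trace_eq_sum_pow, h2, Nat.card_eq_fintype_card]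
  simp [Finset.sum_range_succ]

lemma norm_two (h2 : Module.finrank K L = 2) (x : L) :
    algebraMap K L (Algebra.norm K x) = x * x ^ Fintype.card K := by
  rw [FiniteField.algebraMap_norm_eq_prod_pow, h2, Nat.card_eq_fintype_card]
  simp [Finset.prod_range_succ]

/-- Norm on units. -/
noncomputable def Nm : Lˣ →* Kˣ := Units.map (Algebra.norm K)

lemma Nm_val (x : Lˣ) : ((Nm K L x : Kˣ) : K) = Algebra.norm K (x : L) := rfl

/-- Norm and trace. -/
noncomputable def eL (x : Lˣ) : Kˣ × K := (Nm K L x, Algebra.trace K L (x : L))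

/-- Product and sum. -/
def eK (a : Kˣ × Kˣ) : Kˣ × K := (a.1 * a.2, (a.1 : K) + a.2)

lemma card_le_two_of_quadratic {L : Type*} [Field L] (t v : L) (s : Finset L)
    (hs : ∀ y ∈ s, y ^ 2 - t * y + v = 0) : s.card ≤ 2 := by
  by_contra! h
  obtain ⟨a, b, c, ha, hb, hc, hab, hac, hbc⟩ := Finset.two_lt_card_iff.1 h
  have h1 : (a - b) * (a + b - t) = 0 := by linear_combination hs a ha - hs b hb
  have h2 : (a - c) * (a + c - t) = 0 := by linear_combination hs a ha - hs c hc
  have h1' := (mul_eq_zero.1 h1).resolve_left (sub_ne_zero.2 hab)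
  have h2' := (mul_eq_zero.1 h2).resolve_left (sub_ne_zero.2 hac)
  exact hbc (by linear_combination h1' - h2')

open scoped Classical in
lemma count_le (h2 : Module.finrank K L = 2) (w : Kˣ × K) :
    (Finset.univ.filter fun x : Lˣ => eL K L x = w).card +
      (Finset.univ.filter fun a : Kˣ × Kˣ => eK K a = w).card ≤ 2 := by
  obtain ⟨v, t⟩ := w
  set A := Finset.univ.filter fun x : Lˣ => eL K L x = (v, t) with hA
  set B := Finset.univ.filter fun a : Kˣ × Kˣ => eK K a = (v, t) with hB
  let fA : Lˣ → L := fun x => (x : L)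
  let fB : Kˣ × Kˣ → L := fun a => algebraMap K L (a.1 : K)
  have hfA : Function.Injective fA := fun x y h => Units.ext h
  have hrA : ∀ x ∈ A, (fA x) ^ 2 - algebraMap K L t * fA x + algebraMap K L v = 0 := by
    intro x hx
    rw [hA, Finset.mem_filter] at hx
    obtain ⟨hn, ht⟩ := Prod.ext_iff.1 hx.2
    simp only [eL] at hn ht
    rw [← hn, ← ht, Nm_val, trace_two K L h2, norm_two K L h2]
    simp only [fA]
    ring
  have hB' : ∀ a ∈ B, (a.1 : K) * a.2 = v ∧ (a.1 : K) + a.2 = t := by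
    intro a ha
    rw [hB, Finset.mem_filter] at ha
    obtain ⟨hn, ht⟩ := Prod.ext_iff.1 ha.2
    refine ⟨?_, ht⟩
    exact congrArg Units.val hn
  have hrB : ∀ a ∈ B, (fB a) ^ 2 - algebraMap K L t * fB a + algebraMap K L v = 0 := by
    intro a ha
    obtain ⟨h1, h2⟩ := hB' a ha
    rw [← h1, ← h2]
    simp only [fB, map_add, map_mul]
    ring
  have hfB : Set.InjOn fB B := by
    intro a ha b hb hab
    have h1 : (a.1 : K) = b.1 := (algebraMap K L).injective hab
    have h2 : (a.2 : K) = b.2 := by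
      linear_combination (hB' a ha).2 - (hB' b hb).2 - h1
    exact Prod.ext (Units.ext h1) (Units.ext h2)
  have hcA : (A.image fA).card = A.card := Finset.card_image_of_injective _ hfA
  have hcB : (B.image fB).card = B.card := Finset.card_image_of_injOn hfB
  rw [← hcA, ← hcB]
  by_cases hdis : Disjoint (A.image fA) (B.image fB)
  · rw [← Finset.card_union_of_disjoint hdis]
    apply card_le_two_of_quadratic (algebraMap K L t) (algebraMap K L v)
    intro y hy
    rcases Finset.mem_union.1 hy with hy | hy
    · obtain ⟨x, hx, rfl⟩ := Finset.mem_image.1 hy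
      exact hrA x hx
    · obtain ⟨x, hx, rfl⟩ := Finset.mem_image.1 hy
      exact hrB x hx
  · rw [Finset.not_disjoint_iff] at hdis
    obtain ⟨y, hyA, hyB⟩ := hdis
    obtain ⟨x, hx, rfl⟩ := Finset.mem_image.1 hyA
    obtain ⟨a, ha, hax⟩ := Finset.mem_image.1 hyB
    rw [hA, Finset.mem_filter] at hx
    obtain ⟨hn, ht⟩ := Prod.ext_iff.1 hx.2
    simp only [eL] at hn ht
    have e1 := trace_two K L h2 x
    have e2 := norm_two K L h2 x
    have hxa : (x : L) = algebraMap K L (a.1 : K) := hax.symm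
    have e3 : (x : L) ^ Fintype.card K = x := by
      rw [hxa, ← map_pow, FiniteField.pow_card]
    rw [e3] at e1 e2
    rw [ht] at e1
    rw [← Nm_val, hn] at e2
    have hsub : ∀ y : L, y ^ 2 - algebraMap K L t * y + algebraMap K L v = 0 → y = x := by
      intro y hy
      rw [e1, e2] at hy
      have : (y - x) ^ 2 = 0 := by linear_combination hy
      exact sub_eq_zero.1 (pow_eq_zero_iff (two_ne_zero) |>.1 this)
    have c1 : (A.image fA).card ≤ 1 := by
      rw [Finset.card_le_one]
      intro y hy z hz
      obtain ⟨y', hy', rfl⟩ := Finset.mem_image.1 hy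
      obtain ⟨z', hz', rfl⟩ := Finset.mem_image.1 hz
      rw [hsub _ (hrA y' hy'), hsub _ (hrA z' hz')]
    have c2 : (B.image fB).card ≤ 1 := by
      rw [Finset.card_le_one]
      intro y hy z hz
      obtain ⟨y', hy', rfl⟩ := Finset.mem_image.1 hy
      obtain ⟨z', hz', rfl⟩ := Finset.mem_image.1 hz
      rw [hsub _ (hrB y' hy'), hsub _ (hrB z' hz')]
    omega

lemma card_quadratic (h2 : Module.finrank K L = 2) :
    Fintype.card L = Fintype.card K ^ 2 := by
  rw [Module.card_eq_pow_finrank (K := K), h2]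

open scoped Classical in
lemma count_eq (h2 : Module.finrank K L = 2) (w : Kˣ × K) :
    (Finset.univ.filter fun x : Lˣ => eL K L x = w).card +
      (Finset.univ.filter fun a : Kˣ × Kˣ => eK K a = w).card = 2 := by
  have hsum : ∑ w : Kˣ × K, ((Finset.univ.filter fun x : Lˣ => eL K L x = w).card +
      (Finset.univ.filter fun a : Kˣ × Kˣ => eK K a = w).card) = ∑ _w : Kˣ × K, 2 := by
    rw [Finset.sum_add_distrib]
    rw [← Finset.card_eq_sum_card_fiberwise (fun _ _ => Finset.mem_coe.2 (Finset.mem_univ _)),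
      ← Finset.card_eq_sum_card_fiberwise (fun _ _ => Finset.mem_coe.2 (Finset.mem_univ _))]
    simp only [Finset.card_univ, Fintype.card_prod, Fintype.card_units, Finset.sum_const,
      smul_eq_mul]
    rw [card_quadratic K L h2]
    obtain ⟨s, hs⟩ := Nat.exists_eq_add_of_le (Fintype.card_pos (α := K))
    rw [hs]
    have : (0 + 1 + s) ^ 2 - 1 = 2 * s + s ^ 2 := by
      have : (0 + 1 + s) ^ 2 = 2 * s + s ^ 2 + 1 := by ring
      omega
    have h3 : 0 + 1 + s - 1 = s := by omega
    simp only [Nat.succ_eq_add_one] at *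
    rw [this, h3]
    ring
  exact (Finset.sum_eq_sum_iff_of_le (fun w _ => count_le K L h2 w)).1 hsum w (Finset.mem_univ _)

open scoped Classical in
lemma HD_general (h2 : Module.finrank K L = 2) (f : K → ℂ) :
    (∑ x : Lˣ, MonoidAlgebra.single (Nm K L x) (f (Algebra.trace K L (x : L)))) +
      ∑ a : Kˣ, ∑ b : Kˣ, MonoidAlgebra.single (a * b) (f ((a : K) + b)) =
    ∑ v : Kˣ, MonoidAlgebra.single v (2 * ∑ t : K, f t) := by
  let G : Kˣ × K → MonoidAlgebra ℂ Kˣ := fun w => MonoidAlgebra.single w.1 (f w.2)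
  have e1 : (∑ x : Lˣ, MonoidAlgebra.single (Nm K L x) (f (Algebra.trace K L (x : L)))) =
      ∑ x : Lˣ, G (eL K L x) := rfl
  have e2 : ∑ a : Kˣ, ∑ b : Kˣ, MonoidAlgebra.single (a * b) (f ((a : K) + b)) =
      ∑ a : Kˣ × Kˣ, G (eK K a) := by
    rw [Fintype.sum_prod_type]
    rfl
  rw [e1, e2, ← Finset.sum_fiberwise' _ (eL K L) G, ← Finset.sum_fiberwise' _ (eK K) G,
    ← Finset.sum_add_distrib]
  simp_rw [Finset.sum_const, ← add_smul]
  simp_rw [count_eq K L h2]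
  rw [Fintype.sum_prod_type]
  refine Finset.sum_congr rfl fun v _ => ?_
  ext g
  simp [G, Finset.mul_sum, MonoidAlgebra.coeff_sum, Finsupp.single_apply]
  exact fun h h' => absurd h' h

end HD
section Conv

open scoped Classical in
lemma sum_units {F : Type*} [Field F] [Fintype F] {M : Type*} [AddCommMonoid M] (f : F → M) :
    ∑ x : F, f x = f 0 + ∑ x : Fˣ, f x := by
  rw [← Finset.add_sum_erase _ _ (Finset.mem_univ (0 : F))]
  congr 1
  symm
  refine Finset.sum_bij (fun (x : Fˣ) _ => (x : F)) ?_ ?_ ?_ ?_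
  · intro x _
    simp
  · intro x _ y _ h
    exact Units.ext h
  · intro b hb
    exact ⟨Units.mk0 b (Finset.ne_of_mem_erase hb), Finset.mem_univ _, rfl⟩
  · intro x _
    rfl

variable (p : ℕ) [Fact p.Prime] (F : Type*) [Field F] [Fintype F] [Algebra (ZMod p) F]

open scoped Classical in
/-- Group ring Gauss sum. -/
noncomputable def gS : MonoidAlgebra ℂ Fˣ := ∑ x : Fˣ, MonoidAlgebra.single x (psi p F x)

open scoped Classical in
/-- Twisted group ring Gauss sum. -/
noncomputable def hS (d : ℕ) : MonoidAlgebra ℂ Fˣ :=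
  ∑ x : Fˣ, MonoidAlgebra.single x⁻¹ (psi p F ((x : F) ^ d))

open scoped Classical in
/-- Sum of all group elements. -/
noncomputable def tS : MonoidAlgebra ℂ Fˣ := ∑ x : Fˣ, MonoidAlgebra.single x 1

open scoped Classical in
/-- The Weil sums as an element of the group ring. -/
noncomputable def wS (d : ℕ) : MonoidAlgebra ℂ Fˣ :=
  ∑ x : Fˣ, MonoidAlgebra.single x (weilSum p F d x)

lemma tS_mul_single (x : Fˣ) (c : ℂ) : tS F * MonoidAlgebra.single x c = c • tS F := by
  classical
  unfold tS
  rw [Finset.sum_mul, Finset.smul_sum, ← Equiv.sum_comp (Equiv.mulRight x) (fun y : Fˣ => c • MonoidAlgebra.single y (1 : ℂ))]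
  refine Finset.sum_congr rfl fun y _ => ?_
  rw [MonoidAlgebra.single_mul_single]
  simp

open scoped Classical in
lemma sum_psi_units : ∑ x : Fˣ, psi p F x = -1 := by
  have h1 := sum_psi_mul p F 1
  simp only [one_mul, one_ne_zero, if_false] at h1
  rw [sum_units, psi_zero] at h1
  linear_combination h1

lemma tS_mul_gS : tS F * gS p F = - tS F := by
  classical
  unfold gS
  rw [Finset.mul_sum]
  simp_rw [tS_mul_single]
  rw [← Finset.sum_smul, sum_psi_units]
  simp

open scoped Classical in
lemma sum_psi_pow_units (d : ℕ) (hd : 0 < d) (hcop : Nat.Coprime d (Fintype.card F - 1)) :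
    ∑ x : Fˣ, psi p F ((x : F) ^ d) = -1 := by
  have h1 := sum_psi_mul_pow p F d hd hcop 1
  simp only [one_mul, one_ne_zero, if_false] at h1
  rw [sum_units, zero_pow hd.ne', psi_zero] at h1
  linear_combination h1

lemma tS_mul_hS (d : ℕ) (hd : 0 < d) (hcop : Nat.Coprime d (Fintype.card F - 1)) :
    tS F * hS p F d = - tS F := by
  classical
  unfold hS
  rw [Finset.mul_sum]
  simp_rw [tS_mul_single]
  rw [← Finset.sum_smul, sum_psi_pow_units p F d hd hcop]
  simp

lemma tS_mul_tS : tS F * tS F = ((Fintype.card F : ℂ) - 1) • tS F := by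
  classical
  conv_lhs => rhs; rw [tS]
  rw [Finset.mul_sum]
  simp_rw [tS_mul_single, one_smul]
  rw [Finset.sum_const, Finset.card_univ, Fintype.card_units, ← Nat.cast_smul_eq_nsmul ℂ,
    Nat.cast_sub Fintype.card_pos, Nat.cast_one]

lemma wS_eq (d : ℕ) (hd : 0 < d) : wS p F d = tS F + gS p F * hS p F d := by
  classical
  have h1 : ∀ u : Fˣ, weilSum p F d u = 1 + ∑ x : Fˣ, psi p F ((x : F) ^ d) * psi p F (u * x) := by
    intro u
    unfold weilSum
    rw [sum_units]
    simp [hd.ne', psi_zero, psi_add]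
  have h2 : gS p F * hS p F d = ∑ x : Fˣ, ∑ u : Fˣ,
      MonoidAlgebra.single u (psi p F ((x : F) ^ d) * psi p F (u * x)) := by
    unfold gS hS
    rw [Finset.mul_sum]
    refine Finset.sum_congr rfl fun x _ => ?_
    rw [Finset.sum_mul]
    rw [← Equiv.sum_comp (Equiv.mulRight x) (fun y : Fˣ => MonoidAlgebra.single y (psi p F y) *
      MonoidAlgebra.single x⁻¹ (psi p F ((x : F) ^ d)))]
    refine Finset.sum_congr rfl fun y _ => ?_
    rw [MonoidAlgebra.single_mul_single]
    simp [mul_comm]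
  rw [h2, Finset.sum_comm, wS, tS, ← Finset.sum_add_distrib]
  refine Finset.sum_congr rfl fun u _ => ?_
  rw [h1, MonoidAlgebra.single_add]
  congr 1
  exact map_sum (MonoidAlgebra.singleAddHom u) _ _

/-- The hom `x ↦ x ^ (-d)`. -/
def invPow (d : ℕ) : Fˣ →* Fˣ where
  toFun x := (x ^ d)⁻¹
  map_one' := by simp
  map_mul' x y := by rw [mul_pow, mul_inv]

lemma map_hS (d : ℕ) (hd : 0 < d) (hcop : Nat.Coprime d (Fintype.card F - 1)) :
    MonoidAlgebra.mapDomainRingHom ℂ (invPow F d) (hS p F d) = gS p F := by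
  classical
  have hb : Function.Bijective fun x : Fˣ => x ^ d := by
    apply Finite.injective_iff_bijective.1
    intro x y h
    apply Units.ext
    apply pow_d_injective d hd hcop
    simpa using congrArg Units.val h
  unfold hS gS
  rw [map_sum, ← hb.sum_comp (fun x : Fˣ => MonoidAlgebra.single x (psi p F x))]
  refine Finset.sum_congr rfl fun x _ => ?_
  simp [invPow]

variable (K L : Type*) [Field K] [Fintype K] [Field L] [Fintype L] [Algebra K L]
  [Algebra (ZMod p) K] [Algebra (ZMod p) L] 

lemma psi_trace (x : L) : psi p L x = psi p K (Algebra.trace K L x) := by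
  have : IsScalarTower (ZMod p) K L := IsScalarTower.of_algebraMap_eq' (Subsingleton.elim _ _)
  rw [psi_eq, psi_eq, Algebra.trace_trace]

lemma HD_gS (h2 : Module.finrank K L = 2) :
    MonoidAlgebra.mapDomainRingHom ℂ (Nm K L) (gS p L) = - (gS p K * gS p K) := by
  classical
  have h := HD_general K L h2 (psi p K)
  have h0 : ∑ t : K, psi p K t = 0 := by
    have h1 := sum_psi_mul p K 1
    simpa using h1
  rw [h0] at h
  simp only [mul_zero, MonoidAlgebra.single_zero, Finset.sum_const_zero] at h
  rw [eq_neg_iff_add_eq_zero, ← h]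
  congr 1
  · unfold gS
    rw [map_sum]
    refine Finset.sum_congr rfl fun x _ => ?_
    simp [psi_trace p K L]
  · unfold gS
    rw [Finset.sum_mul_sum]
    refine Finset.sum_congr rfl fun a _ => Finset.sum_congr rfl fun b _ => ?_
    rw [MonoidAlgebra.single_mul_single, psi_add]

lemma HD_tS (h2 : Module.finrank K L = 2) :
    MonoidAlgebra.mapDomainRingHom ℂ (Nm K L) (tS L) = ((Fintype.card K : ℂ) + 1) • tS K := by
  classical
  have h := HD_general K L h2 (fun _ => 1)
  have e1 : MonoidAlgebra.mapDomainRingHom ℂ (Nm K L) (tS L) + tS K * tS K =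
      (2 * (Fintype.card K : ℂ)) • tS K := by
    convert h using 1
    · congr 1
      · unfold tS
        rw [map_sum]
        refine Finset.sum_congr rfl fun x _ => ?_
        simp
      · unfold tS
        rw [Finset.sum_mul_sum]
        refine Finset.sum_congr rfl fun a _ => Finset.sum_congr rfl fun b _ => ?_
        rw [MonoidAlgebra.single_mul_single, one_mul]
    · unfold tS
      rw [Finset.smul_sum]
      simp
  rw [tS_mul_tS] at e1
  rw [eq_sub_of_add_eq e1, ← sub_smul]
  congr 1
  ring

lemma coprime_sub (h2 : Module.finrank K L = 2) (d : ℕ)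
    (hcop : Nat.Coprime d (Fintype.card L - 1)) : Nat.Coprime d (Fintype.card K - 1) := by
  refine Nat.Coprime.coprime_dvd_right ?_ hcop
  rw [card_quadratic K L h2]
  simpa using Nat.sub_dvd_pow_sub_pow (Fintype.card K) 1 2

lemma HD_hS (h2 : Module.finrank K L = 2) (d : ℕ) (hd : 0 < d)
    (hcop : Nat.Coprime d (Fintype.card L - 1)) :
    MonoidAlgebra.mapDomainRingHom ℂ (Nm K L) (hS p L d) = - (hS p K d * hS p K d) := by
  have hcK := coprime_sub K L h2 d hcop
  have hinj : Function.Injective (MonoidAlgebra.mapDomainRingHom ℂ (invPow K d)) := by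
    apply MonoidAlgebra.mapDomain_injective
    intro x y h
    apply Units.ext
    apply pow_d_injective d hd hcK
    have h' : (x ^ d)⁻¹ = (y ^ d)⁻¹ := h
    simpa using congrArg Units.val (inv_injective h')
  apply hinj
  rw [map_neg, map_mul, map_hS p K d hd hcK, ← HD_gS p K L h2, ← map_hS p L d hd hcop,
    ← RingHom.comp_apply, ← RingHom.comp_apply, ← MonoidAlgebra.mapDomainRingHom_comp,
    ← MonoidAlgebra.mapDomainRingHom_comp]
  congr 2
  ext x
  simp [invPow]

lemma wS_sq (h2 : Module.finrank K L = 2) (d : ℕ) (hd : 0 < d)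
    (hcop : Nat.Coprime d (Fintype.card L - 1)) :
    MonoidAlgebra.mapDomainRingHom ℂ (Nm K L) (wS p L d) = wS p K d ^ 2 := by
  have hcK := coprime_sub K L h2 d hcop
  rw [wS_eq p L d hd, wS_eq p K d hd, map_add, map_mul, HD_gS p K L h2, HD_hS p K L h2 d hd hcop,
    HD_tS K L h2]
  have e1 := tS_mul_gS p K
  have e2 := tS_mul_hS p K d hd hcK
  have e3 := tS_mul_tS K
  have e4 : ((Fintype.card K : ℂ) + 1) • tS K = ((Fintype.card K : ℂ) - 1) • tS K + 2 * tS K := by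
    rw [two_mul, ← add_assoc, add_assoc, ← two_smul ℂ (tS K), ← add_smul]
    congr 1
    ring
  rw [e4, ← e3]
  linear_combination (-2 * hS p K d) * e1 + 2 * e2

lemma dvd_descend (h2 : Module.finrank K L = 2) (d : ℕ) (hd : 0 < d)
    (hcop : Nat.Coprime d (Fintype.card L - 1)) (k : ℕ) (hk : 1 ≤ k)
    (hK : Fintype.card K = p ^ k)
    (mL : L → ℤ) (hmL : ∀ u, weilSum p L d u = mL u)
    (mK : K → ℤ) (hmK : ∀ u, weilSum p K d u = mK u) (e : ℕ)
    (hdvd : ∀ u : Lˣ, (p : ℤ) ^ (2 * e + 1) ∣ mL u) (u : Kˣ) : (p : ℤ) ^ (e + 1) ∣ mK u := by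
  classical
  let zL : MonoidAlgebra ℤ Lˣ := ∑ x : Lˣ, MonoidAlgebra.single x (mL x)
  let zK : MonoidAlgebra ℤ Kˣ := ∑ x : Kˣ, MonoidAlgebra.single x (mK x)
  have hzL : MonoidAlgebra.mapRingHom Lˣ (Int.castRingHom ℂ) zL = wS p L d := by
    simp only [zL, wS, map_sum]
    refine Finset.sum_congr rfl fun x _ => ?_
    simp [hmL]
  have hzK : MonoidAlgebra.mapRingHom Kˣ (Int.castRingHom ℂ) zK = wS p K d := by
    simp only [zK, wS, map_sum]
    refine Finset.sum_congr rfl fun x _ => ?_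
    simp [hmK]
  have hinj : Function.Injective (MonoidAlgebra.mapRingHom Kˣ (Int.castRingHom ℂ)) := by
    intro x y hxy
    ext g
    have := congrArg (fun y => MonoidAlgebra.coeff y g) hxy
    simpa [MonoidAlgebra.coeff_mapRingHom] using this
  have hsq : MonoidAlgebra.mapDomainRingHom ℤ (Nm K L) zL = zK ^ 2 := by
    apply hinj
    rw [map_pow, hzK, ← wS_sq p K L h2 d hd hcop, ← hzL, ← RingHom.comp_apply,
      MonoidAlgebra.mapRingHom_comp_mapDomainRingHom]
    rfl
  have h1 : (((p : ℤ) ^ (2 * e + 1) : ℤ) : MonoidAlgebra ℤ Lˣ) ∣ zL := by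
    apply Finset.dvd_sum
    intro x _
    obtain ⟨c, hc⟩ := hdvd x
    refine ⟨MonoidAlgebra.single x c, ?_⟩
    rw [MonoidAlgebra.intCast_def, MonoidAlgebra.single_mul_single, one_mul, hc]
    simp
  have h3 : (((p : ℤ) ^ (2 * e + 1) : ℤ) : MonoidAlgebra ℤ Kˣ) ∣ zK ^ 2 := by
    rw [← hsq]
    have := map_dvd (MonoidAlgebra.mapDomainRingHom ℤ (Nm K L)) h1
    rwa [map_intCast] at this
  have h4 := groupRing_sq p k hk (fun g => by
    apply Units.ext
    rw [Units.val_pow_eq_pow_val, ← hK, FiniteField.pow_card]) e zK h3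
  rw [groupRing_dvd_iff] at h4
  have h5 := h4 u
  have h6 : zK.coeff u = mK u := by
    simp [zK, MonoidAlgebra.coeff_sum, Finsupp.single_apply]
  rwa [h6] at h5

end Conv

section ThreeValued

lemma num_cycle (p n N : ℕ) (hp : p.Prime) (hp2 : p ≠ 2) (S : ℤ)
    (hq : 3 * N + 1 = p ^ n) (hS : (N : ℤ) * S = (p : ℤ) ^ n) : False := by
  have h1 : (N : ℤ) ∣ ((p ^ n : ℕ) : ℤ) := ⟨S, by push_cast; exact hS.symm⟩
  have h2 : N ∣ p ^ n := by exact_mod_cast h1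
  rw [← hq] at h2
  have h3 : N ∣ 1 := (Nat.dvd_add_right (Dvd.intro_left 3 rfl)).1 h2
  have h4 : N = 1 := Nat.dvd_one.1 h3
  subst h4
  have hn : n ≠ 0 := by
    rintro rfl
    simp at hq
  have h5 : p ∣ 2 ^ 2 := by
    have : p ∣ p ^ n := dvd_pow_self p hn
    rw [← hq] at this
    simpa using this
  exact hp2 ((Nat.prime_dvd_prime_iff_eq hp Nat.prime_two).1 (hp.dvd_of_dvd_pow h5))

lemma num_swap (p n NA N : ℕ) (hp : p.Prime) (hp5 : 5 ≤ p) (A S D : ℤ)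
    (hNA : 1 ≤ NA) (hN : 1 ≤ N)
    (hq : NA + 2 * N + 1 = p ^ n) (h1 : (NA : ℤ) * A + N * S = (p : ℤ) ^ n)
    (hD : (N : ℤ) * D = ((p : ℤ) ^ n) ^ 2) (h2 : 2 * ((NA : ℤ) * A ^ 2) + N * (S ^ 2 - D) = 0)
    (hne : A = 0 → S ^ 2 ≠ D) : False := by
  have hn : n ≠ 0 := by
    rintro rfl
    simp at hq
    omega
  set q : ℤ := (p : ℤ) ^ n with hqdef
  have hq' : (NA : ℤ) + 2 * N + 1 = q := by
    rw [hqdef]; exact_mod_cast hq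
  have key : (NA : ℤ) * ((q - 1) * A ^ 2 - 2 * q * A) = q ^ 2 * (N - 1) := by
    have e1 : (N : ℤ) * S = q - NA * A := by linarith
    have e2 : (2 * N * NA * A ^ 2 : ℤ) + ((N : ℤ) * S) ^ 2 = N * (N * D) := by
      linear_combination (N : ℤ) * h2
    rw [e1, hD] at e2
    rw [show q - 1 = (NA : ℤ) + 2 * N by linarith]
    linear_combination e2
  rcases Nat.lt_or_ge 1 N with hN1 | hN1
  · -- N > 1
    have hNd : N ∣ (p ^ n) ^ 2 := by
      have : (N : ℤ) ∣ (((p ^ n) ^ 2 : ℕ) : ℤ) := ⟨D, by push_cast; exact hD.symm⟩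
      exact_mod_cast this
    rw [← pow_mul] at hNd
    obtain ⟨k, -, hk⟩ := (Nat.dvd_prime_pow hp).1 hNd
    have hk0 : k ≠ 0 := by
      rintro rfl
      simp at hk
      omega
    have hpN : p ∣ N := by rw [hk]; exact dvd_pow_self p hk0
    have hpq : p ∣ p ^ n := dvd_pow_self p hn
    have hcopNA : Nat.Coprime NA p := by
      rw [Nat.coprime_comm, Nat.Prime.coprime_iff_not_dvd hp]
      intro hpA
      rw [← hq] at hpq
      have : p ∣ 1 := (Nat.dvd_add_right (dvd_add hpA (hpN.mul_left 2))).1 hpq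
      exact hp.one_lt.ne' (Nat.dvd_one.1 this)
    have hdv : NA ∣ (p ^ n) ^ 2 * (N - 1) := by
      have : (NA : ℤ) ∣ (((p ^ n) ^ 2 * (N - 1) : ℕ) : ℤ) := by
        refine ⟨((q - 1) * A ^ 2 - 2 * q * A), ?_⟩
        rw [key]
        push_cast [Nat.cast_sub hN]
        rfl
      exact_mod_cast this
    have hdv2 : NA ∣ N - 1 :=
      Nat.Coprime.dvd_of_dvd_mul_left ((hcopNA.pow_right n).pow_right 2) hdv
    have hle : NA ≤ N - 1 := Nat.le_of_dvd (by omega) hdv2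
    have hlt : p ^ k < p ^ n := by omega
    have hkn : k < n := (Nat.pow_lt_pow_iff_right hp.one_lt).1 hlt
    have h6 : p ^ (k + 1) ≤ p ^ n := Nat.pow_le_pow_right hp.pos hkn
    rw [pow_succ, ← hk, ← hq] at h6
    have h7 : N * 5 ≤ N * p := Nat.mul_le_mul_left N hp5
    omega
  · have : N = 1 := by omega
    subst this
    have hz : (NA : ℤ) * ((q - 1) * A ^ 2 - 2 * q * A) = 0 := by rw [key]; simp
    have hNA0 : (NA : ℤ) ≠ 0 := by exact_mod_cast (by omega : NA ≠ 0)
    have hz2 : A * ((q - 1) * A - 2 * q) = 0 := by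
      have := (mul_eq_zero.1 hz).resolve_left hNA0
      linear_combination this
    rcases mul_eq_zero.1 hz2 with hA | hA
    · apply hne hA
      subst hA
      simp at h2
      linarith
    · have hdv : (q - 1) ∣ 2 := ⟨A - 2, by linear_combination -hA⟩
      have h7 := Int.le_of_dvd (by norm_num) hdv
      have h8 : (1 : ℤ) ≤ NA := by exact_mod_cast hNA
      have h9 : (p : ℤ) ≤ q := by
        rw [hqdef]
        exact_mod_cast Nat.le_of_dvd (pow_pos hp.pos n) (dvd_pow_self p hn)
      have : (5 : ℤ) ≤ p := by exact_mod_cast hp5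
      linarith

open scoped Classical in
/-- size of a fibre -/
noncomputable def fib {U : Type*} [Fintype U] (w : U → ℂ) (A : ℂ) : ℕ :=
  (Finset.univ.filter (fun u => w u = A)).card

lemma sum3 {U : Type*} [Fintype U] (w f : U → ℂ) (A B C A' B' C' : ℂ)
    (hAB : A ≠ B) (hAC : A ≠ C) (hBC : B ≠ C)
    (hr : ∀ u, w u = A ∨ w u = B ∨ w u = C)
    (hA : ∀ u, w u = A → f u = A') (hB : ∀ u, w u = B → f u = B')
    (hC : ∀ u, w u = C → f u = C') :
    ∑ u, f u = fib w A * A' + fib w B * B' + fib w C * C' := by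
  classical
  have : ∀ u, f u = (if w u = A then A' else 0) + (if w u = B then B' else 0)
      + (if w u = C then C' else 0) := by
    intro u
    rcases hr u with h | h | h
    · rw [hA u h]; simp [h, hAB, hAC]
    · rw [hB u h]; simp [h, hAB.symm, hBC]
    · rw [hC u h]; simp [h, hAC.symm, hBC.symm]
  simp_rw [this, Finset.sum_add_distrib, ← Finset.sum_filter, Finset.sum_const, nsmul_eq_mul]
  unfold fib
  congr!

lemma fib_eq {U : Type*} [Fintype U] (w : U → ℂ) (s : U ≃ U) (A B : ℂ)
    (h : ∀ u, w u = A ↔ w (s u) = B) : fib w A = fib w B := by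
  classical
  unfold fib
  refine Finset.card_bij (fun u _ => s u) ?_ ?_ ?_
  · intro u hu
    simp at hu ⊢
    exact (h u).1 hu
  · intro a _ b _ hab
    exact s.injective hab
  · intro b hb
    refine ⟨s.symm b, ?_, by simp⟩
    simp at hb ⊢
    rw [h]
    simpa using hb

lemma fib_pos {U : Type*} [Fintype U] (w : U → ℂ) (a : U) : 1 ≤ fib w (w a) := by
  classical
  unfold fib
  exact Finset.card_pos.2 ⟨a, by simp⟩

/-- The case where the Galois action swaps two values. -/
lemma swap_false {U : Type*} [Fintype U] (p n : ℕ) (hp : p.Prime) (hp5 : 5 ≤ p)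
    (w : U → ℂ) (s : U ≃ U) (hU : Fintype.card U + 1 = p ^ n)
    (hIntg : ∀ u, IsIntegral ℤ (w u)) (a b c : U)
    (hab : w a ≠ w b) (hac : w a ≠ w c) (hbc : w b ≠ w c)
    (hr : ∀ u, w u = w a ∨ w u = w b ∨ w u = w c)
    (hs : ∀ u v, w u = w v ↔ w (s u) = w (s v))
    (h1 : ∑ u, w u = (p : ℂ) ^ n) (h2 : ∑ u, w u * w u = ((p : ℂ) ^ n) ^ 2)
    (h0 : ∑ u, w u * w (s u) = 0) (hAint : (w (s a) = w a → ∃ m : ℤ, w a = m))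
    (ha : w (s a) = w a) (hb : w (s b) = w c) (hc : w (s c) = w b) : False := by
  obtain ⟨A, hA⟩ := hAint ha
  have hN : fib w (w b) = fib w (w c) := by
    apply fib_eq w s
    intro u
    rw [hs u b, hb]
  have e0 := sum3 w (fun _ => 1) (w a) (w b) (w c) 1 1 1 hab hac hbc hr (by simp) (by simp) (by simp)
  have e1 := sum3 w w (w a) (w b) (w c) (w a) (w b) (w c) hab hac hbc hr
    (fun u h => h) (fun u h => h) (fun u h => h)
  have e2 := sum3 w (fun u => w u * w u) (w a) (w b) (w c) (w a * w a) (w b * w b) (w c * w c)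
    hab hac hbc hr (fun u h => by simp only [h]) (fun u h => by simp only [h])
    (fun u h => by simp only [h])
  have e3 := sum3 w (fun u => w u * w (s u)) (w a) (w b) (w c) (w a * w a) (w b * w c) (w c * w b)
    hab hac hbc hr (fun u h => by simp only [h, (hs u a).1 h, ha])
    (fun u h => by simp only [h, (hs u b).1 h, hb])
    (fun u h => by simp only [h, (hs u c).1 h, hc])
  rw [h1] at e1
  rw [h2] at e2
  rw [h0] at e3
  have pA := fib_pos w a
  have pB := fib_pos w b
  rw [← hN] at e0 e1 e2 e3
  generalize fib w (w a) = NA at *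
  generalize fib w (w b) = N at *
  have hq : NA + 2 * N + 1 = p ^ n := by
    rw [← hU]
    simp at e0
    have : Fintype.card U = NA + N + N := by exact_mod_cast e0
    omega
  have hN0 : (N : ℤ) ≠ 0 := by exact_mod_cast (by omega : N ≠ 0)
  have hN0' : (N : ℂ) ≠ 0 := by exact_mod_cast (by omega : N ≠ 0)
  have iB := hIntg b
  have iC := hIntg c
  have eD : (N : ℂ) * (w b - w c) ^ 2 = ((p : ℂ) ^ n) ^ 2 := by
    linear_combination -e2 + e3
  obtain ⟨D, hD⟩ := int_of_integral_rat ((w b - w c) ^ 2) ((iB.sub iC).pow 2)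
    (((p : ℤ) ^ n) ^ 2) N hN0 (by push_cast; exact eD)
  obtain ⟨S, hS⟩ := int_of_integral_rat (w b + w c) (iB.add iC)
    ((p : ℤ) ^ n - NA * A) N hN0 (by push_cast; rw [← hA]; linear_combination -e1)
  refine num_swap p n NA N hp hp5 A S D pA pB hq ?_ ?_ ?_ ?_
  · have : (NA : ℂ) * A + N * S = (p : ℂ) ^ n := by rw [← hA, ← hS]; linear_combination -e1
    exact_mod_cast this
  · have : (N : ℂ) * D = ((p : ℂ) ^ n) ^ 2 := by rw [← hD]; exact eD
    exact_mod_cast this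
  · have : 2 * ((NA : ℂ) * A ^ 2) + N * (S ^ 2 - D) = 0 := by
      rw [← hA, ← hS, ← hD]; linear_combination -2 * e3
    exact_mod_cast this
  · intro hA0 hSD
    have hSD' : ((S : ℂ)) ^ 2 = D := by exact_mod_cast hSD
    rw [← hS, ← hD] at hSD'
    have : w b * w c = 0 := by linear_combination hSD' / 4
    have hA1 : w a = 0 := by rw [hA, hA0]; simp
    rcases mul_eq_zero.1 this with h | h
    · exact hab (by rw [hA1, h])
    · exact hac (by rw [hA1, h])

/-- The case where the Galois action permutes the values cyclically. -/
lemma cycle_false {U : Type*} [Fintype U] (p n : ℕ) (hp : p.Prime) (hp5 : 5 ≤ p)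
    (w : U → ℂ) (s : U ≃ U) (hU : Fintype.card U + 1 = p ^ n)
    (hIntg : ∀ u, IsIntegral ℤ (w u)) (a b c : U)
    (hab : w a ≠ w b) (hac : w a ≠ w c) (hbc : w b ≠ w c)
    (hr : ∀ u, w u = w a ∨ w u = w b ∨ w u = w c)
    (hs : ∀ u v, w u = w v ↔ w (s u) = w (s v))
    (h1 : ∑ u, w u = (p : ℂ) ^ n)
    (ha : w (s a) = w b) (hb : w (s b) = w c) : False := by
  have hN : fib w (w b) = fib w (w c) := by
    apply fib_eq w s
    intro u
    rw [hs u b, hb]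
  have hN2 : fib w (w a) = fib w (w b) := by
    apply fib_eq w s
    intro u
    rw [hs u a, ha]
  have e0 := sum3 w (fun _ => 1) (w a) (w b) (w c) 1 1 1 hab hac hbc hr (by simp) (by simp) (by simp)
  have e1 := sum3 w w (w a) (w b) (w c) (w a) (w b) (w c) hab hac hbc hr
    (fun u h => h) (fun u h => h) (fun u h => h)
  rw [h1] at e1
  have pB := fib_pos w b
  rw [hN2, ← hN] at e0 e1
  generalize fib w (w b) = N at *
  have hq : 3 * N + 1 = p ^ n := by
    rw [← hU]
    simp at e0
    have : Fintype.card U = N + N + N := by exact_mod_cast e0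
    omega
  have hN0 : (N : ℤ) ≠ 0 := by exact_mod_cast (by omega : N ≠ 0)
  obtain ⟨S, hS⟩ := int_of_integral_rat (w a + w b + w c) (((hIntg a).add (hIntg b)).add (hIntg c))
    ((p : ℤ) ^ n) N hN0 (by push_cast; linear_combination -e1)
  refine num_cycle p n N hp (by omega) S hq ?_
  have : (N : ℂ) * S = (p : ℂ) ^ n := by rw [← hS]; linear_combination -e1
  exact_mod_cast this

/-- A map induced on the values by a permutation is injective. -/
lemma val_inj {U : Type*} [Fintype U] (w : U → ℂ) (s : U ≃ U)
    (h : ∀ u v, w u = w v → w (s u) = w (s v)) (u v : U) :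
    w u = w v ↔ w (s u) = w (s v) := by
  refine ⟨h u v, fun huv => ?_⟩
  have hit : ∀ (k : ℕ) (u v : U), w u = w v → w ((s ^ k) u) = w ((s ^ k) v) := by
    intro k
    induction k with
    | zero => intro u v h; simpa using h
    | succ k ih =>
      intro u v h'
      rw [pow_succ']
      exact h _ _ (ih _ _ h')
  have ho : 0 < orderOf (s : Equiv.Perm U) := orderOf_pos _
  have h1 : ∀ x, ((s : Equiv.Perm U) ^ (orderOf (s : Equiv.Perm U) - 1)) (s x) = x := by
    intro x
    rw [← Equiv.Perm.mul_apply, ← pow_succ, Nat.sub_add_cancel ho, pow_orderOf_eq_one]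
    rfl
  have := hit (orderOf (s : Equiv.Perm U) - 1) _ _ huv
  rwa [h1, h1] at this

lemma three_false {U : Type*} [Fintype U] (p n : ℕ) (hp : p.Prime) (hp5 : 5 ≤ p)
    (w : U → ℂ) (s : U ≃ U) (hU : Fintype.card U + 1 = p ^ n)
    (hIntg : ∀ u, IsIntegral ℤ (w u)) (a b c : U)
    (hab : w a ≠ w b) (hac : w a ≠ w c) (hbc : w b ≠ w c)
    (hr : ∀ u, w u = w a ∨ w u = w b ∨ w u = w c)
    (hs' : ∀ u v, w u = w v → w (s u) = w (s v))
    (h1 : ∑ u, w u = (p : ℂ) ^ n) (h2 : ∑ u, w u * w u = ((p : ℂ) ^ n) ^ 2)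
    (h0 : ∑ u, w u * w (s u) = 0) (hAint : ∀ u, (w (s u) = w u → ∃ m : ℤ, w u = m)) :
    False := by
  have hs := val_inj w s hs'
  have nab : w (s a) ≠ w (s b) := fun h => hab ((hs _ _).2 h)
  have nac : w (s a) ≠ w (s c) := fun h => hac ((hs _ _).2 h)
  have nbc : w (s b) ≠ w (s c) := fun h => hbc ((hs _ _).2 h)
  have rr1 : ∀ u, w u = w a ∨ w u = w c ∨ w u = w b := fun u => by have := hr u; tauto
  have rr2 : ∀ u, w u = w b ∨ w u = w a ∨ w u = w c := fun u => by have := hr u; tauto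
  have rr3 : ∀ u, w u = w c ∨ w u = w a ∨ w u = w b := fun u => by have := hr u; tauto
  rcases hr (s a) with ha | ha | ha <;> rcases hr (s b) with hb | hb | hb <;>
    rcases hr (s c) with hc | hc | hc <;>
    first
    | exact absurd (ha.trans hb.symm) nab
    | exact absurd (ha.trans hc.symm) nac
    | exact absurd (hb.trans hc.symm) nbc
    | exact swap_false p n hp hp5 w s hU hIntg a b c hab hac hbc hr hs h1 h2 h0 (hAint a) ha hb hc
    | exact swap_false p n hp hp5 w s hU hIntg b a c hab.symm hbc hac rr2 hs h1 h2 h0 (hAint b) hb ha hc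
    | exact swap_false p n hp hp5 w s hU hIntg c a b hac.symm hbc.symm hab rr3 hs h1 h2 h0 (hAint c)
        hc ha hb
    | exact cycle_false p n hp hp5 w s hU hIntg a b c hab hac hbc hr hs h1 ha hb
    | exact cycle_false p n hp hp5 w s hU hIntg a c b hac hab hbc.symm rr1 hs h1 ha hc
    | skip
  -- identity
  have : ∀ u, w (s u) = w u := by
    intro u
    rcases hr u with h | h | h
    · rw [(hs u a).1 h, ha, h]
    · rw [(hs u b).1 h, hb, h]
    · rw [(hs u c).1 h, hc, h]
  simp_rw [this] at h0
  rw [h0] at h2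
  have hp0 : (p : ℂ) ≠ 0 := by exact_mod_cast hp.ne_zero
  exact (pow_ne_zero 2 (pow_ne_zero n hp0)) h2.symm

theorem hd1_of_three (p : ℕ) [Fact p.Prime] (F : Type*) [Field F] [Fintype F]
    [Algebra (ZMod p) F] (n : ℕ) (hn : Fintype.card F = p ^ n)
    (d : ℕ) (hd : 0 < d) (hcop : Nat.Coprime d (Fintype.card F - 1))
    (h3 : (Set.range fun u : Fˣ => weilSum p F d u).ncard = 3) (b : ZMod p) : b ^ d = b := by
  classical
  have hp : p.Prime := Fact.out
  have hdv : p - 1 ∣ Fintype.card F - 1 := by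
    rw [hn]
    simpa using Nat.sub_dvd_pow_sub_pow p 1 n
  have hcop' : Nat.Coprime d (p - 1) := hcop.coprime_dvd_right hdv
  have hfer : ∀ x : ZMod p, x ≠ 0 → x ^ (p - 1) = 1 := fun x hx => ZMod.pow_card_sub_one_eq_one hx
  have hsmall : p - 1 ∣ d - 1 → b ^ d = b := by
    rintro ⟨k, hk⟩
    rcases eq_or_ne b 0 with rfl | hb
    · exact zero_pow hd.ne'
    · have : d = (p - 1) * k + 1 := by omega
      rw [this, pow_succ, pow_mul, hfer b hb, one_pow, one_mul]
  rcases Nat.lt_or_ge p 5 with hp5 | hp5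
  · apply hsmall
    have h2 := hp.two_le
    interval_cases p
    · simp
    · have : ¬ 2 ∣ d := by
        intro h
        have := Nat.dvd_gcd h (dvd_refl 2)
        rw [hcop'] at this
        omega
      simp
      omega
    · exact absurd hp (by norm_num)
  by_contra hbd
  obtain ⟨g, hg⟩ := IsCyclic.exists_generator (α := (ZMod p)ˣ)
  have hb0 : b ≠ 0 := by
    rintro rfl
    exact hbd (zero_pow hd.ne')
  have hgd : (g : ZMod p) ^ d ≠ g := by
    intro h
    have h' : g ^ d = g := by ext; simpa using h
    obtain ⟨k, hk⟩ := Subgroup.mem_zpowers_iff.1 (hg (Units.mk0 b hb0))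
    apply hbd
    have : (Units.mk0 b hb0) ^ d = Units.mk0 b hb0 := by
      rw [← hk, ← zpow_natCast, ← zpow_mul, mul_comm, zpow_mul, zpow_natCast, h']
    simpa using congrArg Units.val this
  -- multiplier
  set l : (ZMod p)ˣ := g ^ d * g⁻¹ with hl
  have hl1 : l ≠ 1 := by
    intro h
    rw [hl, mul_inv_eq_one] at h
    apply hgd
    simpa using congrArg Units.val h
  have hlg : (l : ZMod p) * g = (g : ZMod p) ^ d := by
    rw [← Units.val_mul, ← Units.val_pow_eq_pow_val, hl]; simp
  set lF : Fˣ := Units.map (algebraMap (ZMod p) F).toMonoidHom l with hlF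
  have hlFv : ∀ u : Fˣ, ((lF * u : Fˣ) : F) = algebraMap (ZMod p) F l * u := by
    intro u; simp [hlF]
  have hlF1 : algebraMap (ZMod p) F l ≠ 1 := by
    intro h
    apply hl1
    ext
    apply (algebraMap (ZMod p) F).injective
    simpa using h
  have hact : ∀ u v : Fˣ, weilSum p F d u = weilSum p F d v →
      weilSum p F d ((lF * u : Fˣ) : F) = weilSum p F d ((lF * v : Fˣ) : F) := by
    intro u v h
    rw [hlFv, hlFv, ← tw_eq p F d g l g.ne_zero hlg, ← tw_eq p F d g l g.ne_zero hlg]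
    exact tw_galois p F d u v h _ (pow_ne_zero _ g.ne_zero)
  obtain ⟨A, B, C, hAB, hAC, hBC, hrange⟩ := Set.ncard_eq_three.1 h3
  have hmem : ∀ X, X ∈ ({A, B, C} : Set ℂ) → ∃ u : Fˣ, weilSum p F d u = X := by
    intro X hX
    rw [← hrange] at hX
    exact hX
  obtain ⟨a, rfl⟩ := hmem A (by simp)
  obtain ⟨b', rfl⟩ := hmem B (by simp)
  obtain ⟨c, rfl⟩ := hmem C (by simp)
  have hr : ∀ u : Fˣ, weilSum p F d u = weilSum p F d a ∨ weilSum p F d u = weilSum p F d b' ∨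
      weilSum p F d u = weilSum p F d c := by
    intro u
    have : weilSum p F d u ∈ (Set.range fun u : Fˣ => weilSum p F d u) := ⟨u, rfl⟩
    rw [hrange] at this
    simpa using this
  have hz := weil_zero p F d hd hcop
  have s1 := sum_weil p F d hd
  rw [sum_units, hz, zero_add, hn] at s1
  have s2 := sum_weil_mul p F d hd hcop 1
  rw [sum_units, hz, zero_mul, zero_add, hn] at s2
  have s0 := sum_weil_mul p F d hd hcop (algebraMap (ZMod p) F l)
  rw [sum_units, hz, zero_mul, zero_add, if_neg hlF1] at s0
  refine three_false p n hp hp5 (fun u : Fˣ => weilSum p F d u) (Equiv.mulLeft lF) ?_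
    (fun u => weil_isIntegral p F d u) a b' c hAB hAC hBC hr hact ?_ ?_ ?_ ?_
  · rw [← hn, Fintype.card_units]
    exact Nat.sub_add_cancel Fintype.card_pos
  · simpa using s1
  · simpa using s2
  · simpa only [Equiv.coe_mulLeft, hlFv] using s0
  · intro u hu
    apply int_of_tw p F d u
    intro x hx
    have hit : ∀ k : ℕ, weilSum p F d ((lF ^ k * u : Fˣ) : F) = weilSum p F d u := by
      intro k
      induction k with
      | zero => simp
      | succ k ih =>
        rw [pow_succ', mul_assoc, hact _ _ ih]
        exact hu
    have hcardZ : Fintype.card (ZMod p) = p := ZMod.card p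
    obtain ⟨y, hy⟩ := (pow_d_bijective (F := ZMod p) d hd (by rw [hcardZ]; exact hcop')).2 x
    have hy' : y ^ d = x := hy
    have hy0 : y ≠ 0 := by
      rintro rfl
      rw [zero_pow hd.ne'] at hy'
      exact hx hy'.symm
    obtain ⟨k, hk⟩ := (mem_powers_iff_mem_zpowers.2 (hg (Units.mk0 y hy0)))
    have hk' : g ^ k = Units.mk0 y hy0 := hk
    have hlk : ((l ^ k : (ZMod p)ˣ) : ZMod p) * y = y ^ d := by
      have : l ^ k * Units.mk0 y hy0 = (Units.mk0 y hy0) ^ d := by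
        rw [← hk', hl, mul_pow, ← pow_mul, ← pow_mul, inv_pow, inv_mul_cancel_right, mul_comm]
      simpa using congrArg Units.val this
    rw [← hy', tw_eq p F d y _ hy0 hlk, ← hit k]
    congr 1
    simp [hlF]

end ThreeValued

section Main

lemma addv_prime (p : ℕ) [Fact p.Prime] (F : Type*) [Field F] [Fintype F]
    [Algebra (ZMod p) F] (hn : Fintype.card F = p) (d : ℕ)
    (hd1 : ∀ b : ZMod p, b ^ d = b) : Addv d F := by
  have hbij : Function.Bijective (algebraMap (ZMod p) F) := by
    rw [Fintype.bijective_iff_injective_and_card]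
    exact ⟨(algebraMap (ZMod p) F).injective, by rw [ZMod.card, hn]⟩
  have : ∀ x : F, x ^ d = x := by
    intro x
    obtain ⟨b, rfl⟩ := hbij.2 x
    rw [← map_pow, hd1]
  intro x y
  rw [this, this, this]

/-- The inductive claim for a single field. -/
def Claim (p : ℕ) [Fact p.Prime] (F : Type*) [Field F] [Fintype F]
    [Algebra (ZMod p) F] (d e : ℕ) : Prop :=
  ∃ u : Fˣ, ∃ m : ℤ, weilSum p F d u = m ∧ ¬ (p : ℤ) ^ (e + 1) ∣ m

lemma claim_step (p : ℕ) [Fact p.Prime] (F : Type*) [Field F] [Fintype F]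
    [Algebra (ZMod p) F] (K : Type*) [Field K] [Fintype K] [Algebra (ZMod p) K] [Algebra K F]
    (k : ℕ) (hk : 1 ≤ k) (hK : Fintype.card K = p ^ k) (h2 : Module.finrank K F = 2)
    (d : ℕ) (hd : 0 < d) (hcop : Nat.Coprime d (Fintype.card F - 1))
    (hd1 : ∀ b : ZMod p, b ^ d = b) (hF : ¬ Addv d F)
    (ih : ¬ Addv d K → Claim p K d (k / 2)) : Claim p F d k := by
  have hp : p.Prime := Fact.out
  choose mF hmF using int_of_hd1 p F d hd1
  choose mK hmK using int_of_hd1 p K d hd1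
  by_contra hno
  have hdiv : ∀ u : Fˣ, (p : ℤ) ^ (k + 1) ∣ mF u := by
    intro u
    by_contra h
    exact hno ⟨u, mF u, hmF u, h⟩
  by_cases hA : Addv d K
  · apply hF
    apply addv_of_nonneg p F d hd hcop mF hmF
    intro u
    by_cases hu : u = 0
    · have h0 := weil_zero p F d hd hcop
      rw [← hu, hmF u] at h0
      have : mF u = 0 := by exact_mod_cast h0
      rw [this]
    · have hge := niho_ge p F K (card_quadratic K F h2) d hd hA u (mF u) (hmF u)
      rw [hK] at hge
      obtain ⟨t, ht⟩ := hdiv (Units.mk0 u hu)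
      simp only [Units.val_mk0] at ht
      by_contra hneg
      push Not at hneg
      have hp1 : (2 : ℤ) ≤ p := by exact_mod_cast hp.two_le
      have hpk : (0 : ℤ) < (p : ℤ) ^ k := by positivity
      have hpk1 : (0 : ℤ) < (p : ℤ) ^ (k + 1) := by positivity
      have ht0 : t < 0 := by
        by_contra h
        push Not at h
        have := mul_nonneg hpk1.le h
        linarith
      push_cast at hge
      have h3 : (p : ℤ) ^ (k + 1) * t ≤ (p : ℤ) ^ (k + 1) * (-1) :=
        mul_le_mul_of_nonneg_left (by omega) hpk1.le
      rw [pow_succ] at h3 ht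
      nlinarith
  · obtain ⟨u, m, hm, hnd⟩ := ih hA
    apply hnd
    have hmm : m = mK u := by
      have := hm.symm.trans (hmK u)
      exact_mod_cast this
    rw [hmm]
    refine dvd_descend p K F h2 d hd hcop k hk hK mF hmF mK hmK (k / 2) ?_ u
    intro v
    exact (pow_dvd_pow _ (by omega)).trans (hdiv v)

lemma exists_sub (p : ℕ) [Fact p.Prime] (F : Type*) [Field F] [Fintype F]
    [Algebra (ZMod p) F] (k : ℕ) (hk : 1 ≤ k) (hF : Fintype.card F = p ^ (2 * k)) :
    ∃ _ : Algebra (GaloisField p k) F, Module.finrank (GaloisField p k) F = 2 := by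
  have hp : p.Prime := Fact.out
  have hfr : Module.finrank (ZMod p) F = 2 * k := by
    have h := Module.card_eq_pow_finrank (K := ZMod p) (V := F)
    rw [ZMod.card, hF] at h
    exact (Nat.pow_right_injective hp.two_le h).symm
  have hfk : Module.finrank (ZMod p) (GaloisField p k) = k := GaloisField.finrank p (by omega)
  obtain ⟨f⟩ := FiniteField.nonempty_algHom_of_finrank_dvd (F := ZMod p)
    (K := GaloisField p k) (L := F) (by rw [hfr, hfk]; exact Dvd.intro_left 2 rfl)
  letI : Algebra (GaloisField p k) F := f.toRingHom.toAlgebra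
  refine ⟨inferInstance, ?_⟩
  haveI : IsScalarTower (ZMod p) (GaloisField p k) F := IsScalarTower.of_algHom f
  have := Module.finrank_mul_finrank (ZMod p) (GaloisField p k) F
  rw [hfr, hfk] at this
  have hk' : 0 < k := hk
  apply Nat.eq_of_mul_eq_mul_left hk'
  rw [this, mul_comm]

lemma claim_aux (p : ℕ) [Fact p.Prime] (F : Type*) [Field F] [Fintype F]
    [Algebra (ZMod p) F] (j : ℕ) (hn : Fintype.card F = p ^ (2 ^ (j + 1)))
    (d : ℕ) (hd : 0 < d) (hcop : Nat.Coprime d (Fintype.card F - 1))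
    (hd1 : ∀ b : ZMod p, b ^ d = b) (hF : ¬ Addv d F)
    (ih : ∀ (K : Type) [Field K] [Fintype K] [Algebra (ZMod p) K],
      Fintype.card K = p ^ (2 ^ j) → Nat.Coprime d (Fintype.card K - 1) → ¬ Addv d K →
      Claim p K d (2 ^ j / 2)) : Claim p F d (2 ^ (j + 1) / 2) := by
  have hk : 1 ≤ 2 ^ j := Nat.one_le_two_pow
  obtain ⟨alg, h2⟩ := exists_sub p F (2 ^ j) hk (by rw [hn, pow_succ']) 
  letI : Fintype (GaloisField p (2 ^ j)) := Fintype.ofFinite _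
  have hK : Fintype.card (GaloisField p (2 ^ j)) = p ^ (2 ^ j) := by
    rw [← Nat.card_eq_fintype_card]
    exact GaloisField.card p (2 ^ j) (by omega)
  have h4 : 2 ^ (j + 1) / 2 = 2 ^ j := by
    rw [pow_succ]; omega
  rw [h4]
  exact claim_step p F (GaloisField p (2 ^ j)) (2 ^ j) hk hK h2 d hd hcop hd1 hF
    (ih (GaloisField p (2 ^ j)) hK (coprime_sub _ F h2 d hcop))

lemma claim_type (p : ℕ) [Fact p.Prime] (d : ℕ) (hd : 0 < d)
    (hd1 : ∀ b : ZMod p, b ^ d = b) (j : ℕ) :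
    ∀ (K : Type) [Field K] [Fintype K] [Algebra (ZMod p) K],
      Fintype.card K = p ^ (2 ^ j) → Nat.Coprime d (Fintype.card K - 1) → ¬ Addv d K →
      Claim p K d (2 ^ j / 2) := by
  induction j with
  | zero =>
    intro K _ _ _ hK _ hA
    exact absurd (addv_prime p K (by simpa using hK) d hd1) hA
  | succ j ih =>
    intro K _ _ _ hK hc hA
    exact claim_aux p K j hK d hd hc hd1 hA ih

end Main

open scoped Classical in
theorem stmt_18 (p : ℕ) [Fact p.Prime] (F : Type*) [Field F] [Fintype F]
    [Algebra (ZMod p) F] (n j : ℕ) (hnj : n = 2 ^ j)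
    (hn : Fintype.card F = p ^ n)
    (d : ℕ) (hd : 0 < d) (hcop : Nat.Coprime d (Fintype.card F - 1))
    (h3 : (Set.range fun u : Fˣ => weilSum p F d u).ncard = 3) :
    ∃ u : Fˣ, ∃ m : ℤ, m ≠ 0 ∧ weilSum p F d u = (m : ℂ) ∧
      2 * padicValInt p m ≤ n := by
  have hd1 := hd1_of_three p F n hn d hd hcop h3
  have hF := not_addv p F d hd hd1 h3
  subst hnj
  have hc : Claim p F d (2 ^ j / 2) := by
    cases j with
    | zero => exact absurd (addv_prime p F (by simpa using hn) d hd1) hF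
    | succ j => exact claim_aux p F j hn d hd hcop hd1 hF (claim_type p d hd hd1 j)
  obtain ⟨u, m, hm, hnd⟩ := hc
  have hm0 : m ≠ 0 := by
    rintro rfl
    exact hnd (dvd_zero _)
  refine ⟨u, m, hm0, hm, ?_⟩
  rw [padicValInt_dvd_iff] at hnd
  push Not at hnd
  have := hnd.2
  omega
end
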